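/- arXiv:2309.02661 — 9 statements merged into one kernel-verified Lean document; each statement's English description precedes it below -/
import Mathlib

section
/- Let θ > 0, λ > 0 and β ∈ (0,1). Suppose f : (0,∞) → [0,∞) is measurable, monotone on some interval (0,δ) with δ > 0, and satisfies ∫_0^∞ e^{-sx} f(x) dx = 1/(1 + θ((s+λ)^β − λ^β)) for all s > 0. Then f(x) ∼ x^{β-1}/(θ Γ(β)) as x → 0^+; that is, lim_{x→0^+} θ Γ(β) x^{1-β} f(x) = 1. -/
open Real Filter MeasureTheory

section Karamata

open Set Topology

lemma exp_neg_mul_mem_Icc {s x : ℝ} (hs : 0 ≤ s) (hx : 0 ≤ x) :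
    Real.exp (-s * x) ∈ Icc (0 : ℝ) 1 :=
  ⟨(Real.exp_pos _).le, Real.exp_le_one_iff.2 (by nlinarith [mul_nonneg hs hx])⟩

lemma integrableOn_comp_exp_neg_mul {g φ : ℝ → ℝ} (hg : Continuous g)
    (hφ : IntegrableOn φ (Ioi 0)) {s : ℝ} (hs : 0 ≤ s) :
    IntegrableOn (fun x => g (Real.exp (-s * x)) * φ x) (Ioi 0) := by
  obtain ⟨C, hC⟩ := isCompact_Icc.exists_bound_of_continuousOn
    (hg.continuousOn (s := Icc (0 : ℝ) 1))
  refine Integrable.bdd_mul (c := C) hφ (by fun_prop) ?_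
  filter_upwards [ae_restrict_mem measurableSet_Ioi] with x hx
  exact hC _ (exp_neg_mul_mem_Icc hs (le_of_lt hx))

lemma abs_integral_comp_exp_neg_mul_sub_le {g p φ : ℝ → ℝ} (hg : Continuous g)
    (hp : Continuous p) (hφ : IntegrableOn φ (Ioi 0)) (hφ0 : ∀ x > 0, 0 ≤ φ x)
    {s ε : ℝ} (hs : 0 ≤ s) (hε : ∀ y ∈ Icc (0 : ℝ) 1, |p y - g y| ≤ ε) :
    |(∫ x in Ioi 0, p (Real.exp (-s * x)) * φ x) - ∫ x in Ioi 0, g (Real.exp (-s * x)) * φ x|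
      ≤ ε * ∫ x in Ioi 0, φ x := by
  rw [← integral_sub (integrableOn_comp_exp_neg_mul hp hφ hs)
    (integrableOn_comp_exp_neg_mul hg hφ hs), ← integral_const_mul, ← Real.norm_eq_abs]
  refine norm_integral_le_of_norm_le (hφ.const_mul ε) ?_
  filter_upwards [ae_restrict_mem measurableSet_Ioi] with x hx
  rw [← sub_mul, norm_mul, Real.norm_eq_abs, Real.norm_of_nonneg (hφ0 x hx)]
  exact mul_le_mul_of_nonneg_right (hε _ (exp_neg_mul_mem_Icc hs (le_of_lt hx))) (hφ0 x hx)

/-- **Karamata's theorem** for polynomial weights. -/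
lemma tendsto_rpow_mul_integral_polynomial {f : ℝ → ℝ} {β K : ℝ} (hβ : 0 < β)
    (hint : ∀ s > 0, IntegrableOn (fun x => Real.exp (-s * x) * f x) (Ioi 0))
    (hL : Tendsto (fun s : ℝ => s ^ β * ∫ x in Ioi 0, Real.exp (-s * x) * f x) atTop
      (𝓝 (K * Real.Gamma β))) (p : Polynomial ℝ) :
    Tendsto (fun s : ℝ => s ^ β * ∫ x in Ioi 0,
        p.eval (Real.exp (-s * x)) * (Real.exp (-s * x) * f x)) atTop
      (𝓝 (K * ∫ x in Ioi 0, p.eval (Real.exp (-1 * x)) * (Real.exp (-x) * x ^ (β - 1)))) := by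
  induction p using Polynomial.induction_on' with
  | add p q hp hq =>
    have hlim := hp.add hq
    rw [← mul_add, ← integral_add
      (integrableOn_comp_exp_neg_mul p.continuous (GammaIntegral_convergent hβ) zero_le_one)
      (integrableOn_comp_exp_neg_mul q.continuous (GammaIntegral_convergent hβ) zero_le_one)]
      at hlim
    simp only [Polynomial.eval_add, add_mul]
    refine hlim.congr' ?_
    filter_upwards [eventually_gt_atTop 0] with s hs
    rw [← mul_add, ← integral_add
      (integrableOn_comp_exp_neg_mul p.continuous (hint s hs) hs.le)
      (integrableOn_comp_exp_neg_mul q.continuous (hint s hs) hs.le)]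
  | monomial n a =>
    have hn : (0 : ℝ) < n + 1 := by positivity
    have hlimit : K * ∫ x in Ioi 0, (Polynomial.monomial n a).eval (Real.exp (-1 * x)) *
        (Real.exp (-x) * x ^ (β - 1)) = a * ((n : ℝ) + 1) ^ (-β) * (K * Real.Gamma β) := by
      have hpow : ∀ x : ℝ, (Polynomial.monomial n a).eval (Real.exp (-1 * x)) *
          (Real.exp (-x) * x ^ (β - 1)) =
            a * (x ^ (β - 1) * Real.exp (-(((n : ℝ) + 1) * x))) := fun x => by
        rw [Polynomial.eval_monomial, ← Real.exp_nat_mul,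
          show -(((n : ℝ) + 1) * x) = n * (-1 * x) + -x by ring, Real.exp_add]
        ring
      simp only [hpow, integral_const_mul, Real.integral_rpow_mul_exp_neg_mul_Ioi hβ hn]
      rw [one_div, Real.inv_rpow hn.le, Real.rpow_neg hn.le]
      ring
    rw [hlimit]
    have hlim := (hL.comp (tendsto_id.const_mul_atTop hn)).const_mul (a * ((n : ℝ) + 1) ^ (-β))
    refine hlim.congr' ?_
    filter_upwards [eventually_gt_atTop 0] with s hs
    have hpow : ∀ x : ℝ, (Polynomial.monomial n a).eval (Real.exp (-s * x)) *
        (Real.exp (-s * x) * f x) = a * (Real.exp (-(((n : ℝ) + 1) * s) * x) * f x) := fun x => by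
      rw [Polynomial.eval_monomial, ← Real.exp_nat_mul,
        show -(((n : ℝ) + 1) * s) * x = n * (-s * x) + -s * x by ring, Real.exp_add]
      ring
    simp only [hpow, integral_const_mul, Function.comp, id]
    rw [Real.mul_rpow hn.le hs.le, Real.rpow_neg hn.le]
    have := (Real.rpow_pos_of_pos hn β).ne'
    field_simp

/-- **Karamata's theorem** for continuous weights. -/
lemma tendsto_rpow_mul_integral_continuous {f : ℝ → ℝ} {β K : ℝ} (hβ : 0 < β)
    (hf : ∀ x > 0, 0 ≤ f x) (hK : 0 ≤ K)
    (hint : ∀ s > 0, IntegrableOn (fun x => Real.exp (-s * x) * f x) (Ioi 0))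
    (hL : Tendsto (fun s : ℝ => s ^ β * ∫ x in Ioi 0, Real.exp (-s * x) * f x) atTop
      (𝓝 (K * Real.Gamma β))) {g : ℝ → ℝ} (hg : Continuous g) :
    Tendsto (fun s : ℝ => s ^ β * ∫ x in Ioi 0,
        g (Real.exp (-s * x)) * (Real.exp (-s * x) * f x)) atTop
      (𝓝 (K * ∫ x in Ioi 0, g (Real.exp (-1 * x)) * (Real.exp (-x) * x ^ (β - 1)))) := by
  have hc : 0 ≤ K * Real.Gamma β := mul_nonneg hK (Real.Gamma_pos_of_pos hβ).le
  rw [Metric.tendsto_atTop']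
  intro ε hε
  set c := K * Real.Gamma β with hcdef
  obtain ⟨η, hη, hηε⟩ : ∃ η > 0, η * (2 * c + 2) = ε :=
    ⟨ε / (2 * c + 2), by positivity, by field_simp⟩
  obtain ⟨p, hp⟩ := exists_polynomial_near_of_continuousOn 0 1 g hg.continuousOn η hη
  have hpoly := tendsto_rpow_mul_integral_polynomial hβ hint hL p
  have hev := (hpoly.eventually (Metric.ball_mem_nhds _ hη)).and
    ((hL.eventually (gt_mem_nhds (lt_add_one c))).and (eventually_gt_atTop 0))
  obtain ⟨N, hN⟩ := eventually_atTop.1 hev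
  refine ⟨N, fun s hs => ?_⟩
  obtain ⟨h1, h2, hs0⟩ := hN s (le_of_lt hs)
  have hsβ : 0 < s ^ β := Real.rpow_pos_of_pos hs0 β
  have h3 := abs_integral_comp_exp_neg_mul_sub_le hg p.continuous (hint s hs0)
    (fun x hx => mul_nonneg (Real.exp_pos _).le (hf x hx)) hs0.le (fun y hy => (hp y hy).le)
  have h4 := abs_integral_comp_exp_neg_mul_sub_le hg p.continuous (GammaIntegral_convergent hβ)
    (fun x hx => mul_nonneg (Real.exp_pos _).le (Real.rpow_nonneg (le_of_lt hx) _))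
    zero_le_one (fun y hy => (hp y hy).le)
  rw [← Real.Gamma_eq_integral hβ] at h4
  rw [Real.dist_eq, abs_lt] at h1
  rw [Real.dist_eq, abs_lt]
  rw [abs_le] at h3 h4
  have h3l := mul_le_mul_of_nonneg_left h3.1 hsβ.le
  have h3r := mul_le_mul_of_nonneg_left h3.2 hsβ.le
  have h4l := mul_le_mul_of_nonneg_left h4.1 hK
  have h4r := mul_le_mul_of_nonneg_left h4.2 hK
  have h2' : η * (s ^ β * ∫ x in Ioi 0, Real.exp (-s * x) * f x) ≤ η * (c + 1) :=
    mul_le_mul_of_nonneg_left h2.le hη.le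
  have h5 : K * (η * Real.Gamma β) = η * c := by rw [hcdef]; ring
  constructor <;> linarith

lemma exists_window {f : ℝ → ℝ} {β K b : ℝ} (hβ : 0 < β)
    (hf : ∀ x > 0, 0 ≤ f x) (hK : 0 ≤ K)
    (hint : ∀ s > 0, IntegrableOn (fun x => Real.exp (-s * x) * f x) (Ioi 0))
    (hL : Tendsto (fun s : ℝ => s ^ β * ∫ x in Ioi 0, Real.exp (-s * x) * f x) atTop
      (𝓝 (K * Real.Gamma β))) (hb : 1 < b) :
    ∃ h : ℝ → ℝ, (∀ x, 0 ≤ h x) ∧ (∀ x ∉ Ioo 1 b, h x = 0) ∧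
      IntegrableOn h (Ioi 0) ∧ 0 < ∫ x in Ioi 0, h x ∧
      IntegrableOn (fun x => h x * x ^ (β - 1)) (Ioi 0) ∧
      (∀ s > 0, IntegrableOn (fun x => h (s * x) * f x) (Ioi 0)) ∧
      Tendsto (fun s : ℝ => s ^ β * ∫ x in Ioi 0, h (s * x) * f x) atTop
        (𝓝 (K * ∫ x in Ioi 0, h x * x ^ (β - 1))) := by
  set g : ℝ → ℝ := fun y => max 0 ((y - Real.exp (-b)) * (Real.exp (-1) - y)) with hgdef
  have hg : Continuous g := by fun_prop
  have hexp : IntegrableOn (fun x : ℝ => Real.exp (-x)) (Ioi 0) := integrableOn_exp_neg_Ioi 0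
  have hh : IntegrableOn (fun x => g (Real.exp (-x)) * Real.exp (-x)) (Ioi 0) := by
    simpa using integrableOn_comp_exp_neg_mul hg hexp zero_le_one
  have hzero : ∀ x ∉ Ioo 1 b, g (Real.exp (-x)) = 0 := by
    intro x hx
    refine max_eq_left ?_
    rcases le_or_gt x 1 with h1 | h1
    · have e1 : Real.exp (-1) ≤ Real.exp (-x) := Real.exp_le_exp.2 (by linarith)
      have e2 : Real.exp (-b) ≤ Real.exp (-x) := Real.exp_le_exp.2 (by linarith)
      exact mul_nonpos_of_nonneg_of_nonpos (by linarith) (by linarith)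
    · have h2 : b ≤ x := not_lt.1 fun h => hx ⟨h1, h⟩
      have e1 : Real.exp (-x) ≤ Real.exp (-1) := Real.exp_le_exp.2 (by linarith)
      have e2 : Real.exp (-x) ≤ Real.exp (-b) := Real.exp_le_exp.2 (by linarith)
      exact mul_nonpos_of_nonpos_of_nonneg (by linarith) (by linarith)
  have hnn : ∀ x, 0 ≤ g (Real.exp (-x)) * Real.exp (-x) := fun x =>
    mul_nonneg (le_max_left _ _) (Real.exp_pos _).le
  refine ⟨fun x => g (Real.exp (-x)) * Real.exp (-x), hnn, fun x hx => by simp [hzero x hx], hh,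
    ?_, ?_, fun s hs => ?_, ?_⟩
  · rw [setIntegral_pos_iff_support_of_nonneg_ae (Eventually.of_forall hnn) hh]
    refine lt_of_lt_of_le ?_ (measure_mono (show Ioo 1 b ⊆ _ from fun x hx => ⟨?_, ?_⟩))
    · simpa using hb
    · have e1 : Real.exp (-x) < Real.exp (-1) := Real.exp_lt_exp.2 (by linarith [hx.1])
      have e2 : Real.exp (-b) < Real.exp (-x) := Real.exp_lt_exp.2 (by linarith [hx.2])
      exact (mul_pos (lt_max_of_lt_right (mul_pos (by linarith) (by linarith)))
        (Real.exp_pos _)).ne'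
    · exact lt_trans zero_lt_one hx.1
  · simpa [mul_assoc] using
      integrableOn_comp_exp_neg_mul hg (GammaIntegral_convergent hβ) zero_le_one
  · simpa [mul_assoc] using integrableOn_comp_exp_neg_mul hg (hint s hs) hs.le
  · simpa [mul_assoc] using tendsto_rpow_mul_integral_continuous hβ hf hK hint hL hg

lemma integral_window_mul_const {h : ℝ → ℝ} {s : ℝ} (hs : 0 < s) (y : ℝ) :
    ∫ x in Ioi 0, h (s * x) * y = s⁻¹ * (∫ x in Ioi 0, h x) * y := by
  rw [integral_mul_const, integral_comp_mul_left_Ioi h 0 hs, mul_zero, smul_eq_mul]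

lemma integrableOn_window_mul_const {h : ℝ → ℝ} (hh : IntegrableOn h (Ioi 0)) {s : ℝ}
    (hs : 0 < s) (y : ℝ) : IntegrableOn (fun x => h (s * x) * y) (Ioi 0) :=
  Integrable.mul_const ((integrableOn_Ioi_comp_mul_left_iff h 0 hs).2 (by simpa using hh)) y

lemma rpow_div_mul_eq {p s β : ℝ} (hp : 0 < p) (hs : 0 < s) (y : ℝ) :
    (p / s) ^ (1 - β) * y = p ^ (1 - β) * (s ^ β * (s⁻¹ * y)) := by
  rw [Real.div_rpow hp.le hs.le, Real.rpow_sub hs, Real.rpow_one]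
  have := (Real.rpow_pos_of_pos hs β).ne'
  field_simp

lemma tendsto_const_div_nhdsGT_zero {p : ℝ} (hp : 0 < p) :
    Tendsto (fun t : ℝ => p / t) (𝓝[>] 0) atTop := by
  simpa [div_eq_mul_inv] using tendsto_inv_nhdsGT_zero.const_mul_atTop hp

lemma eventually_nhdsGT_of_eventually_div {P : ℝ → Prop} {p : ℝ} (hp : 0 < p)
    (h : ∀ᶠ s in atTop, P (p / s)) : ∀ᶠ t in 𝓝[>] 0, P t := by
  filter_upwards [(tendsto_const_div_nhdsGT_zero hp).eventually h, self_mem_nhdsWithin]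
    with t ht ht0
  have : p / (p / t) = t := by
    have := (show (0 : ℝ) < t from ht0).ne'
    field_simp
  rwa [this] at ht

lemma eventually_rpow_mul_lt {f : ℝ → ℝ} {β K b p M : ℝ} (hβ : β ∈ Ioo (0 : ℝ) 1)
    (hf : ∀ x > 0, 0 ≤ f x) (hK : 0 ≤ K)
    (hint : ∀ s > 0, IntegrableOn (fun x => Real.exp (-s * x) * f x) (Ioi 0))
    (hL : Tendsto (fun s : ℝ => s ^ β * ∫ x in Ioi 0, Real.exp (-s * x) * f x) atTop
      (𝓝 (K * Real.Gamma β))) (hb : 1 < b) (hp : 0 < p)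
    (hcmp : ∀ᶠ s : ℝ in atTop, ∀ x, s * x ∈ Ioo 1 b → f (p / s) ≤ f x)
    (hM : p ^ (1 - β) * K < M) :
    ∀ᶠ t in 𝓝[>] (0 : ℝ), t ^ (1 - β) * f t < M := by
  obtain ⟨h, hnn, hzero, hhint, hHpos, hJint, hfint, hlim⟩ :=
    exists_window hβ.1 hf hK hint hL hb
  set H := ∫ x in Ioi 0, h x
  have hJ : ∫ x in Ioi 0, h x * x ^ (β - 1) ≤ H := by
    refine setIntegral_mono_on hJint hhint measurableSet_Ioi fun x _ => ?_
    by_cases hx : x ∈ Ioo 1 b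
    · exact mul_le_of_le_one_right (hnn x)
        (Real.rpow_le_one_of_one_le_of_nonpos hx.1.le (by linarith [hβ.2]))
    · simp [hzero x hx]
  have hpβ : 0 < p ^ (1 - β) := Real.rpow_pos_of_pos hp _
  have hlt : p ^ (1 - β) * (K * ∫ x in Ioi 0, h x * x ^ (β - 1)) < M * H :=
    calc _ ≤ p ^ (1 - β) * (K * H) := by gcongr
      _ = p ^ (1 - β) * K * H := by ring
      _ < M * H := by gcongr
  refine eventually_nhdsGT_of_eventually_div hp ?_
  filter_upwards [(hlim.const_mul (p ^ (1 - β))).eventually (gt_mem_nhds hlt), hcmp,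
    eventually_gt_atTop 0] with s hs hcs hs0
  have hle : s⁻¹ * H * f (p / s) ≤ ∫ x in Ioi 0, h (s * x) * f x := by
    rw [← integral_window_mul_const hs0]
    refine setIntegral_mono_on (integrableOn_window_mul_const hhint hs0 _) (hfint s hs0)
      measurableSet_Ioi fun x _ => ?_
    by_cases hx : s * x ∈ Ioo 1 b
    · exact mul_le_mul_of_nonneg_left (hcs x hx) (hnn _)
    · simp [hzero _ hx]
  refine lt_of_mul_lt_mul_right ?_ hHpos.le
  calc (p / s) ^ (1 - β) * f (p / s) * H
      = p ^ (1 - β) * (s ^ β * (s⁻¹ * H * f (p / s))) := by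
        rw [rpow_div_mul_eq hp hs0]; ring
    _ ≤ p ^ (1 - β) * (s ^ β * ∫ x in Ioi 0, h (s * x) * f x) := by
        have := Real.rpow_pos_of_pos hs0 β
        gcongr
    _ < M * H := hs

lemma eventually_lt_rpow_mul {f : ℝ → ℝ} {β K b p M : ℝ} (hβ : β ∈ Ioo (0 : ℝ) 1)
    (hf : ∀ x > 0, 0 ≤ f x) (hK : 0 ≤ K)
    (hint : ∀ s > 0, IntegrableOn (fun x => Real.exp (-s * x) * f x) (Ioi 0))
    (hL : Tendsto (fun s : ℝ => s ^ β * ∫ x in Ioi 0, Real.exp (-s * x) * f x) atTop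
      (𝓝 (K * Real.Gamma β))) (hb : 1 < b) (hp : 0 < p)
    (hcmp : ∀ᶠ s : ℝ in atTop, ∀ x, s * x ∈ Ioo 1 b → f x ≤ f (p / s))
    (hM : M < p ^ (1 - β) * (K * b ^ (β - 1))) :
    ∀ᶠ t in 𝓝[>] (0 : ℝ), M < t ^ (1 - β) * f t := by
  obtain ⟨h, hnn, hzero, hhint, hHpos, hJint, hfint, hlim⟩ :=
    exists_window hβ.1 hf hK hint hL hb
  set H := ∫ x in Ioi 0, h x with hH
  have hJ : b ^ (β - 1) * H ≤ ∫ x in Ioi 0, h x * x ^ (β - 1) := by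
    rw [hH, mul_comm, ← integral_mul_const]
    refine setIntegral_mono_on (hhint.mul_const _) hJint measurableSet_Ioi fun x _ => ?_
    by_cases hx : x ∈ Ioo 1 b
    · exact mul_le_mul_of_nonneg_left (Real.rpow_le_rpow_of_nonpos (by linarith [hx.1]) hx.2.le
        (by linarith [hβ.2])) (hnn x)
    · simp [hzero x hx]
  have hpβ : 0 < p ^ (1 - β) := Real.rpow_pos_of_pos hp _
  have hlt : M * H < p ^ (1 - β) * (K * ∫ x in Ioi 0, h x * x ^ (β - 1)) :=
    calc M * H < p ^ (1 - β) * (K * b ^ (β - 1)) * H := by gcongr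
      _ = p ^ (1 - β) * (K * (b ^ (β - 1) * H)) := by ring
      _ ≤ _ := by gcongr
  refine eventually_nhdsGT_of_eventually_div hp ?_
  filter_upwards [(hlim.const_mul (p ^ (1 - β))).eventually (lt_mem_nhds hlt), hcmp,
    eventually_gt_atTop 0] with s hs hcs hs0
  have hle : ∫ x in Ioi 0, h (s * x) * f x ≤ s⁻¹ * H * f (p / s) := by
    rw [← integral_window_mul_const hs0]
    refine setIntegral_mono_on (hfint s hs0) (integrableOn_window_mul_const hhint hs0 _)
      measurableSet_Ioi fun x _ => ?_
    by_cases hx : s * x ∈ Ioo 1 b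
    · exact mul_le_mul_of_nonneg_left (hcs x hx) (hnn _)
    · simp [hzero _ hx]
  refine lt_of_mul_lt_mul_right ?_ hHpos.le
  calc M * H < p ^ (1 - β) * (s ^ β * ∫ x in Ioi 0, h (s * x) * f x) := hs
    _ ≤ p ^ (1 - β) * (s ^ β * (s⁻¹ * H * f (p / s))) := by
        have := Real.rpow_pos_of_pos hs0 β
        gcongr
    _ = (p / s) ^ (1 - β) * f (p / s) * H := by
        rw [rpow_div_mul_eq hp hs0]; ring

lemma eventually_window_mem_Ioo {δ b : ℝ} (hδ : 0 < δ) (hb : 1 < b) :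
    ∀ᶠ s : ℝ in atTop, 1 / s ∈ Ioo 0 δ ∧ b / s ∈ Ioo 0 δ ∧
      ∀ x, s * x ∈ Ioo 1 b → x ∈ Ioo 0 δ ∧ 1 / s ≤ x ∧ x ≤ b / s := by
  filter_upwards [eventually_gt_atTop 0, eventually_gt_atTop (b / δ)] with s hs hsb
  have h1 : 0 < 1 / s := by positivity
  have h2 : b / s < δ := by rwa [div_lt_comm₀ hs hδ]
  have h3 : 1 / s < b / s := by gcongr
  refine ⟨⟨h1, h3.trans h2⟩, ⟨h1.trans h3, h2⟩, fun x hx => ?_⟩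
  have h4 : 1 / s ≤ x := by rw [div_le_iff₀ hs]; linarith [hx.1]
  have h5 : x ≤ b / s := by rw [le_div_iff₀ hs]; linarith [hx.2]
  exact ⟨⟨h1.trans_le h4, h5.trans_lt h2⟩, h4, h5⟩

lemma exists_one_lt_of_tendsto {F : ℝ → ℝ} (hF : ContinuousAt F 1) {U : Set ℝ}
    (hU : U ∈ 𝓝 (F 1)) : ∃ b, 1 < b ∧ F b ∈ U := by
  have h : ∀ᶠ b in 𝓝[>] (1 : ℝ), F b ∈ U := (hF.eventually hU).filter_mono nhdsWithin_le_nhds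
  obtain ⟨b, hb, hb1⟩ := (h.and self_mem_nhdsWithin).exists
  exact ⟨b, hb1, hb⟩

/-- The **monotone density** form of Karamata's Tauberian theorem at `0⁺`. -/
theorem tendsto_rpow_mul_of_tendsto_laplace {f : ℝ → ℝ} {β K : ℝ} (hβ : β ∈ Ioo (0 : ℝ) 1)
    (hf : ∀ x > 0, 0 ≤ f x) (hK : 0 ≤ K)
    (hmono : ∃ δ > (0 : ℝ), MonotoneOn f (Ioo 0 δ) ∨ AntitoneOn f (Ioo 0 δ))
    (hint : ∀ s > 0, IntegrableOn (fun x => Real.exp (-s * x) * f x) (Ioi 0))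
    (hL : Tendsto (fun s : ℝ => s ^ β * ∫ x in Ioi 0, Real.exp (-s * x) * f x) atTop
      (𝓝 (K * Real.Gamma β))) :
    Tendsto (fun t : ℝ => t ^ (1 - β) * f t) (𝓝[>] 0) (𝓝 K) := by
  obtain ⟨δ, hδ, hmono⟩ := hmono
  have hcont (r : ℝ) : ContinuousAt (fun b : ℝ => b ^ r) 1 :=
    Real.continuousAt_rpow_const 1 r (Or.inl one_ne_zero)
  rw [tendsto_order]
  refine ⟨fun M hM => ?_, fun M hM => ?_⟩
  · obtain ⟨b, hb, hMb⟩ := exists_one_lt_of_tendsto (F := fun b : ℝ => K * b ^ (β - 1))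
      (continuousAt_const.mul (hcont _)) (U := Ioi M) (Ioi_mem_nhds (by simpa using hM))
    rcases hmono with hmono | hmono
    · refine eventually_lt_rpow_mul hβ hf hK hint hL hb (zero_lt_one.trans hb) (p := b) ?_ ?_
      · filter_upwards [eventually_window_mem_Ioo hδ hb] with s ⟨_, hbs, hs⟩ x hx
        obtain ⟨hxδ, _, hxb⟩ := hs x hx
        exact hmono hxδ hbs hxb
      · refine lt_of_lt_of_le hMb (le_mul_of_one_le_left ?_ ?_)
        · exact mul_nonneg hK (Real.rpow_nonneg (by linarith) _)
        · exact Real.one_le_rpow hb.le (by linarith [hβ.2])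
    · refine eventually_lt_rpow_mul hβ hf hK hint hL hb zero_lt_one ?_
        (by simpa using hMb)
      filter_upwards [eventually_window_mem_Ioo hδ hb] with s ⟨h1s, _, hs⟩ x hx
      obtain ⟨hxδ, hx1, _⟩ := hs x hx
      exact hmono h1s hxδ hx1
  · obtain ⟨b, hb, hMb⟩ := exists_one_lt_of_tendsto (F := fun b : ℝ => b ^ (1 - β) * K)
      ((hcont _).mul continuousAt_const) (U := Iio M) (Iio_mem_nhds (by simpa using hM))
    rcases hmono with hmono | hmono
    · refine eventually_rpow_mul_lt hβ hf hK hint hL hb zero_lt_one ?_ (by simpa using hM)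
      filter_upwards [eventually_window_mem_Ioo hδ hb] with s ⟨h1s, _, hs⟩ x hx
      obtain ⟨hxδ, hx1, _⟩ := hs x hx
      exact hmono h1s hxδ hx1
    · refine eventually_rpow_mul_lt hβ hf hK hint hL hb (zero_lt_one.trans hb) ?_ hMb
      filter_upwards [eventually_window_mem_Ioo hδ hb] with s ⟨_, hbs, hs⟩ x hx
      obtain ⟨hxδ, _, hxb⟩ := hs x hx
      exact hmono hxδ hbs hxb

lemma tendsto_rpow_mul_geometric_tempered_stable {θ lam β : ℝ} (hθ : 0 < θ) (hlam : 0 < lam)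
    (hβ : 0 < β) :
    Tendsto (fun s : ℝ => s ^ β * (1 / (1 + θ * ((s + lam) ^ β - lam ^ β)))) atTop
      (𝓝 (1 / θ)) := by
  have h1 : Tendsto (fun s : ℝ => s ^ (-β)) atTop (𝓝 0) := tendsto_rpow_neg_atTop hβ
  have h2 : Tendsto (fun s : ℝ => (1 + lam / s) ^ β) atTop (𝓝 1) := by
    have h : Tendsto (fun s : ℝ => 1 + lam / s) atTop (𝓝 1) := by
      simpa using (tendsto_const_nhds (x := (1 : ℝ))).add
        (tendsto_id.const_div_atTop lam)
    simpa using h.rpow_const (p := β) (Or.inl one_ne_zero)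
  have h3 : Tendsto (fun s : ℝ => 1 / (s ^ (-β) * (1 - θ * lam ^ β) + θ * (1 + lam / s) ^ β))
      atTop (𝓝 (1 / θ)) := by
    have h := (h1.mul_const (1 - θ * lam ^ β)).add (h2.const_mul θ)
    rw [zero_mul, zero_add, mul_one] at h
    exact tendsto_const_nhds.div h hθ.ne'
  refine h3.congr' ?_
  filter_upwards [eventually_gt_atTop 0] with s hs
  have hsβ : s ^ β ≠ 0 := (Real.rpow_pos_of_pos hs β).ne'
  have h4 : s ^ (-β) * (1 - θ * lam ^ β) + θ * (1 + lam / s) ^ β =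
      (1 + θ * ((s + lam) ^ β - lam ^ β)) / s ^ β := by
    rw [show 1 + lam / s = (s + lam) / s by field_simp, Real.div_rpow (by positivity) hs.le,
      Real.rpow_neg hs.le]
    field_simp
    ring
  rw [h4, one_div_div, mul_one_div]

end Karamata

/-- Tauberian asymptotics at `0⁺` for a density with geometric tempered stable Laplace
transform: `f(x) ∼ x^(β-1)/(θ Γ(β))` as `x → 0⁺`. -/
theorem geometric_tempered_stable_density_asymp
    (θ lam β : ℝ) (hθ : 0 < θ) (hlam : 0 < lam) (hβ : β ∈ Set.Ioo (0 : ℝ) 1)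
    (f : ℝ → ℝ) (hfmeas : Measurable f) (hfnn : ∀ x > 0, 0 ≤ f x)
    (hfmono : ∃ δ > (0 : ℝ), MonotoneOn f (Set.Ioo 0 δ) ∨ AntitoneOn f (Set.Ioo 0 δ))
    (hLap : ∀ s > 0, ∫ x in Set.Ioi (0 : ℝ), Real.exp (-s * x) * f x
      = 1 / (1 + θ * ((s + lam) ^ β - lam ^ β))) :
    Tendsto (fun x : ℝ => θ * Real.Gamma β * x ^ (1 - β) * f x)
      (nhdsWithin 0 (Set.Ioi 0)) (nhds 1) := by
  have hΓ : 0 < Real.Gamma β := Real.Gamma_pos_of_pos hβ.1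
  have hint : ∀ s > 0, IntegrableOn (fun x => Real.exp (-s * x) * f x) (Set.Ioi 0) := by
    intro s hs
    refine Integrable.of_integral_ne_zero ?_
    rw [hLap s hs]
    have : lam ^ β ≤ (s + lam) ^ β :=
      Real.rpow_le_rpow hlam.le (by linarith) hβ.1.le
    have := mul_nonneg hθ.le (sub_nonneg.2 this)
    positivity
  have hL : Tendsto (fun s : ℝ => s ^ β * ∫ x in Set.Ioi 0, Real.exp (-s * x) * f x) atTop
      (nhds (1 / (θ * Real.Gamma β) * Real.Gamma β)) := by
    rw [show 1 / (θ * Real.Gamma β) * Real.Gamma β = 1 / θ by field_simp]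
    refine (tendsto_rpow_mul_geometric_tempered_stable hθ hlam hβ.1).congr' ?_
    filter_upwards [eventually_gt_atTop 0] with s hs
    rw [hLap s hs]
  have h := (tendsto_rpow_mul_of_tendsto_laplace hβ hfnn (by positivity) hfmono hint hL).const_mul
    (θ * Real.Gamma β)
  rw [mul_one_div_cancel (by positivity)] at h
  simpa only [mul_assoc] using h
end

section
/- Let m ∈ ℕ with m ≥ 2, β = 1/m, λ > 0 and θ ∈ (0,1) with θ λ^β > 1, and set s₀ = (λ^β − 1/θ)^m. Define f : (0,∞) → ℝ by f(x) = e^{(s₀−λ)x}/(θ β s₀^{β−1}) + (1/π) ∫_0^∞ [θ e^{−x(y+λ)} y^β sin(πβ)] / [1 + 2θ(y^β cos(πβ) − λ^β) + θ²(y^{2β} − 2 λ^β y^β cos(πβ) + λ^{2β})] dy. Then for every s > 0, ∫_0^∞ e^{−sx} f(x) dx = 1/(1 + θ((s+λ)^β − λ^β)). -/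
open Real MeasureTheory

open Filter Topology in
theorem tendsto_log_add_sub_log_add (r t : ℂ) :
    Tendsto (fun u : ℝ => Complex.log (u + r) - Complex.log (u + t)) atTop (𝓝 0) := by
  have key (z : ℂ) : Tendsto (fun u : ℝ => Complex.log (1 + z / u)) atTop (𝓝 0) := by
    have h : Tendsto (fun u : ℝ => 1 + z * ((u⁻¹ : ℝ) : ℂ)) atTop (𝓝 1) := by
      have h0 : Tendsto (fun u : ℝ => ((u⁻¹ : ℝ) : ℂ)) atTop (𝓝 ((0 : ℝ) : ℂ)) :=
        (Complex.continuous_ofReal.tendsto 0).comp tendsto_inv_atTop_zero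
      simpa using (h0.const_mul z).const_add 1
    have h2 := (continuousAt_clog Complex.one_mem_slitPlane).tendsto.comp h
    simpa [Function.comp_def, div_eq_mul_inv] using h2
  have h := (key r).sub (key t)
  rw [sub_zero] at h
  have hne (z : ℂ) : ∀ᶠ u : ℝ in atTop, ‖z‖ < u := eventually_gt_atTop _
  refine h.congr' ?_
  filter_upwards [eventually_gt_atTop 0, hne r, hne t] with u hu hr ht
  have expand (z : ℂ) (hz : ‖z‖ < u) :
      Complex.log (u + z) = Real.log u + Complex.log (1 + z / u) := by
    have hu' : (u : ℂ) ≠ 0 := by exact_mod_cast hu.ne'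
    rw [← Complex.log_ofReal_mul hu]
    · congr 1; field_simp
    · intro h0
      have : z = -u := by field_simp at h0; linear_combination h0
      rw [this, norm_neg, Complex.norm_real, Real.norm_of_nonneg hu.le] at hz
      exact lt_irrefl _ hz
  rw [expand r hr, expand t ht]; ring

theorem ofReal_add_mem_slitPlane {r : ℂ} (hr : r ∈ Complex.slitPlane) {u : ℝ} (hu : 0 ≤ u) :
    (u : ℂ) + r ∈ Complex.slitPlane := by
  rw [Complex.mem_slitPlane_iff] at hr ⊢
  simp only [Complex.add_re, Complex.ofReal_re, Complex.add_im, Complex.ofReal_im, zero_add]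
  exact hr.imp (fun h => by linarith) id

open Filter in
theorem integrableOn_inv_add_mul_inv_add {r t : ℂ} (hr : r ∈ Complex.slitPlane)
    (ht : t ∈ Complex.slitPlane) :
    IntegrableOn (fun u : ℝ => ((u : ℂ) + r)⁻¹ * ((u : ℂ) + t)⁻¹) (Set.Ioi 0) := by
  have hcont : ContinuousOn (fun u : ℝ => ((u : ℂ) + r)⁻¹ * ((u : ℂ) + t)⁻¹) (Set.Ici 0) := by
    refine ContinuousOn.mul (ContinuousOn.inv₀ (by fun_prop) ?_)
      (ContinuousOn.inv₀ (by fun_prop) ?_)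
    · exact fun u hu => Complex.slitPlane_ne_zero (ofReal_add_mem_slitPlane hr hu)
    · exact fun u hu => Complex.slitPlane_ne_zero (ofReal_add_mem_slitPlane ht hu)
  have hO (z : ℂ) : (fun u : ℝ => ((u : ℂ) + z)⁻¹) =O[atTop] (fun u : ℝ => u ^ (-1 : ℝ)) := by
    refine Asymptotics.IsBigO.of_bound 2 ?_
    filter_upwards [eventually_gt_atTop 0, eventually_ge_atTop (2 * ‖z‖)] with u hu hz
    have h1 : u / 2 ≤ ‖(u : ℂ) + z‖ := by
      have := norm_sub_le ((u : ℂ) + z) z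
      rw [add_sub_cancel_right, Complex.norm_real, Real.norm_of_nonneg hu.le] at this
      linarith
    rw [norm_inv, Real.rpow_neg_one, norm_inv, Real.norm_of_nonneg hu.le]
    calc ‖(u : ℂ) + z‖⁻¹ ≤ (u / 2)⁻¹ := inv_anti₀ (by positivity) h1
      _ = 2 * u⁻¹ := by field_simp
  have hO2 : (fun u : ℝ => ((u : ℂ) + r)⁻¹ * ((u : ℂ) + t)⁻¹) =O[atTop]
      (fun u : ℝ => u ^ (-2 : ℝ)) := by
    refine ((hO r).mul (hO t)).congr' EventuallyEq.rfl ?_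
    filter_upwards [eventually_gt_atTop 0] with u hu
    rw [← Real.rpow_add hu]; norm_num
  exact ((hcont.locallyIntegrableOn measurableSet_Ici).integrableOn_of_isBigO_atTop hO2
    ⟨Set.Ioi 1, Ioi_mem_atTop 1, integrableOn_Ioi_rpow_of_lt (by norm_num) one_pos⟩).mono_set
    Set.Ioi_subset_Ici_self

theorem integral_inv_add_mul_inv_add {r t : ℂ} (hr : r ∈ Complex.slitPlane)
    (ht : t ∈ Complex.slitPlane) (hrt : r ≠ t) :
    ∫ u in Set.Ioi (0 : ℝ), ((u : ℂ) + r)⁻¹ * ((u : ℂ) + t)⁻¹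
      = (Complex.log r - Complex.log t) / (r - t) := by
  have hd (z : ℂ) (hz : z ∈ Complex.slitPlane) (u : ℝ) (hu : 0 ≤ u) :
      HasDerivAt (fun u : ℝ => Complex.log ((u : ℂ) + z)) (((u : ℂ) + z)⁻¹) u := by
    simpa using ((Complex.ofRealCLM.hasDerivAt (x := u)).add_const z).clog_real
      (ofReal_add_mem_slitPlane hz hu)
  have hsub : r - t ≠ 0 := sub_ne_zero.2 hrt
  have hderiv : ∀ u ∈ Set.Ici (0 : ℝ), HasDerivAt
      (fun u : ℝ => (Complex.log (u + t) - Complex.log (u + r)) / (r - t))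
      (((u : ℂ) + r)⁻¹ * ((u : ℂ) + t)⁻¹) u := by
    intro u hu
    refine (((hd t ht u hu).sub (hd r hr u hu)).div_const (r - t)).congr_deriv ?_
    have h1 := Complex.slitPlane_ne_zero (ofReal_add_mem_slitPlane hr hu)
    have h2 := Complex.slitPlane_ne_zero (ofReal_add_mem_slitPlane ht hu)
    field_simp
    ring
  have hlim := (tendsto_log_add_sub_log_add t r).div_const (r - t)
  rw [integral_Ioi_of_hasDerivAt_of_tendsto' hderiv (integrableOn_inv_add_mul_inv_add hr ht) hlim]
  simp only [Complex.ofReal_zero, zero_add]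
  ring

theorem IsPrimitiveRoot.sum_inv_sub {K : Type*} [Field K] {ζ : K} {m : ℕ}
    (hζ : IsPrimitiveRoot ζ m) {x c : K} (h : x ^ m ≠ c ^ m) :
    ∑ j ∈ Finset.range m, (x - c * ζ ^ j)⁻¹ = m * x ^ (m - 1) / (x ^ m - c ^ m) := by
  have hm : 0 < m := by
    rcases Nat.eq_zero_or_pos m with rfl | hm
    · simp at h
    · exact hm
  have hne : x ^ m - c ^ m ≠ 0 := sub_ne_zero.2 h
  have hinv (j : ℕ) : (x - c * ζ ^ j)⁻¹ =
      (∑ i ∈ Finset.range m, x ^ i * (c * ζ ^ j) ^ (m - 1 - i)) / (x ^ m - c ^ m) := by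
    have h1 := geom_sum₂_mul x (c * ζ ^ j) m
    have h2 : (c * ζ ^ j) ^ m = c ^ m := by
      rw [mul_pow, ← pow_mul, mul_comm j m, pow_mul, hζ.pow_eq_one, one_pow, mul_one]
    rw [h2] at h1
    have h3 : x - c * ζ ^ j ≠ 0 := fun h0 => hne (by rw [← h1, h0, mul_zero])
    rw [eq_div_iff hne, ← h1]
    field_simp
  have hpow (k : ℕ) (h0 : k ≠ 0) (hk : k < m) : ∑ j ∈ Finset.range m, (ζ ^ k) ^ j = 0 := by
    have h1 := geom_sum_mul (ζ ^ k) m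
    rw [← pow_mul, mul_comm k m, pow_mul, hζ.pow_eq_one, one_pow, sub_self] at h1
    exact (mul_eq_zero.1 h1).resolve_right (sub_ne_zero.2 (hζ.pow_ne_one_of_pos_of_lt h0 hk))
  rw [Finset.sum_congr rfl fun j _ => hinv j, ← Finset.sum_div, Finset.sum_comm]
  congr 1
  rw [Finset.sum_eq_single (m - 1)]
  · simp
  · intro i hi hne
    have hi' := Finset.mem_range.1 hi
    have : ∀ j ∈ Finset.range m, x ^ i * (c * ζ ^ j) ^ (m - 1 - i) =
        x ^ i * c ^ (m - 1 - i) * (ζ ^ (m - 1 - i)) ^ j := by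
      intro j _
      rw [mul_pow, ← pow_mul, mul_comm j, pow_mul]; ring
    rw [Finset.sum_congr rfl this, ← Finset.mul_sum, hpow _ (by omega) (by omega), mul_zero]
  · intro h; exact absurd (Finset.mem_range.2 (by omega)) h

theorem IsPrimitiveRoot.sum_mul_re_inv_sub {ζ : ℂ} {n : ℕ} (hζ : IsPrimitiveRoot ζ (n + 1))
    (a w : ℝ) :
    2 * ∑ j ∈ Finset.range n, ((n : ℝ) - j) * ((a - w * ζ * ζ ^ j : ℂ)⁻¹).re =
      (n + 1) * ∑ j ∈ Finset.range n, ((a - w * ζ * ζ ^ j : ℂ)⁻¹).re := by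
  have hconj : starRingEnd ℂ ζ = ζ⁻¹ :=
    (Complex.inv_eq_conj (hζ.norm'_eq_one n.succ_ne_zero)).symm
  have hrefl : ∀ j ∈ Finset.range n,
      ((n : ℝ) - (n - 1 - j : ℕ)) * ((a - w * ζ * ζ ^ (n - 1 - j) : ℂ)⁻¹).re =
        ((j : ℝ) + 1) * ((a - w * ζ * ζ ^ j : ℂ)⁻¹).re := by
    intro j hj
    obtain ⟨k, rfl⟩ := Nat.exists_eq_add_of_lt (Finset.mem_range.1 hj)
    have hk : j + k + 1 - 1 - j = k := by omega
    have hinv : ζ * ζ ^ k = (ζ * ζ ^ j)⁻¹ := by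
      refine eq_inv_of_mul_eq_one_left ?_
      rw [← hζ.pow_eq_one]; ring
    have hre : (a - w * ζ * ζ ^ k : ℂ)⁻¹ = starRingEnd ℂ ((a - w * ζ * ζ ^ j : ℂ)⁻¹) := by
      rw [mul_assoc, hinv]
      simp [hconj]
      ring
    rw [hk, hre, Complex.conj_re]
    push_cast; ring
  have h := Finset.sum_range_reflect
    (fun j => ((n : ℝ) - j) * ((a - w * ζ * ζ ^ j : ℂ)⁻¹).re) n
  rw [Finset.sum_congr rfl hrefl] at h
  rw [two_mul]
  nth_rewrite 1 [← h]
  rw [← Finset.sum_add_distrib, Finset.mul_sum]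
  exact Finset.sum_congr rfl fun j _ => by ring

theorem mem_slitPlane_and_log_ofReal_mul_exp {w φ : ℝ} (hw : 0 < w) (h1 : -π < φ) (h2 : φ < π) :
    (w * Complex.exp (φ * Complex.I) : ℂ) ∈ Complex.slitPlane ∧
      Complex.log (w * Complex.exp (φ * Complex.I)) = Real.log w + φ * Complex.I := by
  have hlog : Complex.log (w * Complex.exp (φ * Complex.I)) = Real.log w + φ * Complex.I := by
    rw [Complex.log_ofReal_mul hw (Complex.exp_ne_zero _), Complex.log_exp] <;> simp [h1, h2.le]
  refine ⟨?_, hlog⟩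
  rw [Complex.mem_slitPlane_iff_arg]
  refine ⟨?_, by simp [hw.ne', Complex.exp_ne_zero]⟩
  rw [← Complex.log_im, hlog]
  simp [h2.ne]

theorem integral_pow_div_quadratic_mul_pow_add_pow {m : ℕ} (hm : 2 ≤ m) {a w : ℝ} (ha : 0 < a)
    (haw : a < w) :
    IntegrableOn (fun u : ℝ => m * sin (π / m) * u ^ m /
      ((u ^ 2 - 2 * a * cos (π / m) * u + a ^ 2) * (u ^ m + w ^ m))) (Set.Ioi 0) ∧
    ∫ u in Set.Ioi (0 : ℝ), m * sin (π / m) * u ^ m /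
      ((u ^ 2 - 2 * a * cos (π / m) * u + a ^ 2) * (u ^ m + w ^ m)) =
      π * ((w - a)⁻¹ - m * a ^ (m - 1) / (w ^ m - a ^ m)) := by
  obtain ⟨n, rfl⟩ : ∃ n, m = n + 1 := ⟨m - 1, by omega⟩
  have hw : 0 < w := ha.trans haw
  set α : ℝ := π / (n + 1 : ℕ) with hα
  have hαM : ((n : ℝ) + 1) * α = π := by rw [hα]; push_cast; field_simp
  have hα0 : 0 < α := by positivity
  have hαπ : α < π := by
    have : (1 : ℝ) ≤ n := by exact_mod_cast (by omega : 1 ≤ n)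
    nlinarith
  set E : ℂ := Complex.exp (α * Complex.I) with hE
  have hE0 : E ≠ 0 := Complex.exp_ne_zero _
  have hEM : E ^ (n + 1) = -1 := by
    rw [hE, ← Complex.exp_nat_mul, ← Complex.exp_pi_mul_I]
    congr 1
    rw [← hαM]; push_cast; ring
  have hζ : IsPrimitiveRoot (E ^ 2) (n + 1) := by
    have := Complex.isPrimitiveRoot_exp (n + 1) n.succ_ne_zero
    convert this using 1
    rw [hE, ← Complex.exp_nat_mul]
    congr 1
    rw [hα]; push_cast; ring
  set r : ℂ := -(a * E⁻¹) with hr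
  set t : ℕ → ℂ := fun j => -(w * E * (E ^ 2) ^ j) with ht
  set S : ℕ → ℂ := fun j => (a - w * E ^ 2 * (E ^ 2) ^ j : ℂ)⁻¹ with hS
  have hrform : r = a * Complex.exp ((π - α : ℝ) * Complex.I) := by
    rw [hr, hE, ← Complex.exp_neg]
    push_cast
    rw [sub_mul, sub_eq_add_neg, Complex.exp_add, Complex.exp_pi_mul_I]; ring
  have htform (j : ℕ) : t j = w * Complex.exp (((2 * j + 1) * α - π : ℝ) * Complex.I) := by
    have : (((2 * j + 1) * α - π : ℝ) * Complex.I : ℂ) =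
        (2 * j + 1 : ℕ) * (α * Complex.I) - π * Complex.I := by push_cast; ring
    rw [this, Complex.exp_sub, Complex.exp_nat_mul, Complex.exp_pi_mul_I, ← hE]
    simp only [ht]; ring
  obtain ⟨hrs, hrl⟩ := mem_slitPlane_and_log_ofReal_mul_exp (φ := π - α) ha
    (by linarith) (by linarith)
  rw [← hrform] at hrs hrl
  have htj (j : ℕ) (hj : j ∈ Finset.range (n + 1)) : t j ∈ Complex.slitPlane ∧
      Complex.log (t j) = Real.log w + ((2 * j + 1) * α - π : ℝ) * Complex.I := by
    rw [htform j]
    have hj' : (j : ℝ) ≤ n := by exact_mod_cast Nat.lt_succ_iff.1 (Finset.mem_range.1 hj)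
    have hj0 : (0 : ℝ) ≤ j := j.cast_nonneg
    refine mem_slitPlane_and_log_ofReal_mul_exp hw ?_ ?_ <;> nlinarith
  have hnormE : ‖E‖ = 1 := Complex.norm_exp_ofReal_mul_I α
  have hrt (j : ℕ) : r ≠ t j := by
    intro h
    have := congrArg norm h
    simp [hr, ht, hnormE, abs_of_pos ha, abs_of_pos hw] at this
    exact haw.ne this
  have hpow : a ^ (n + 1) < w ^ (n + 1) := pow_lt_pow_left₀ haw ha.le n.succ_ne_zero
  have hpoint : ∀ u ∈ Set.Ioi (0 : ℝ), ((n + 1 : ℕ) : ℝ) * sin α * u ^ (n + 1) /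
      ((u ^ 2 - 2 * a * cos α * u + a ^ 2) * (u ^ (n + 1) + w ^ (n + 1))) =
      -(∑ j ∈ Finset.range (n + 1), E⁻¹ * (((u : ℂ) + r)⁻¹ * ((u : ℂ) + t j)⁻¹)).im := by
    intro u hu
    have hu0 : (0 : ℝ) < u := hu
    have hsum := hζ.sum_inv_sub (x := (u : ℂ)) (c := w * E) (by
      rw [mul_pow, hEM]
      intro h
      have h' : u ^ (n + 1) = w ^ (n + 1) * (-1) := by exact_mod_cast h
      have := pow_pos hu0 (n + 1)
      have := pow_pos hw (n + 1)
      linarith)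
    have hsum' : ∑ j ∈ Finset.range (n + 1), ((u : ℂ) + t j)⁻¹ =
        (((n + 1 : ℕ) : ℝ) * u ^ n / (u ^ (n + 1) + w ^ (n + 1)) : ℝ) := by
      simp only [ht, ← sub_eq_add_neg]
      rw [hsum, mul_pow, hEM]
      push_cast
      simp
    have hinv : E⁻¹ * ((u : ℂ) + r)⁻¹ = ((u : ℂ) * E - a)⁻¹ := by
      rw [← mul_inv, hr]; congr 1; field_simp; ring
    have hD : Complex.normSq ((u : ℂ) * E - a) = u ^ 2 - 2 * a * cos α * u + a ^ 2 := by
      rw [Complex.normSq_apply, hE]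
      simp [Complex.exp_ofReal_mul_I_re, Complex.exp_ofReal_mul_I_im]
      linear_combination u ^ 2 * sin_sq_add_cos_sq α
    have him : (((u : ℂ) * E - a)⁻¹).im = -(u * sin α) / (u ^ 2 - 2 * a * cos α * u + a ^ 2) := by
      rw [Complex.inv_im, hD]
      simp [hE, Complex.exp_ofReal_mul_I_im]
    simp only [← mul_assoc]
    rw [← Finset.mul_sum, hsum', hinv, Complex.im_mul_ofReal, him, div_mul_div_comm, ← neg_div]
    congr 1; ring
  have hint : ∀ j ∈ Finset.range (n + 1), IntegrableOn
      (fun u : ℝ => E⁻¹ * (((u : ℂ) + r)⁻¹ * ((u : ℂ) + t j)⁻¹)) (Set.Ioi 0) := fun j hj =>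
    (integrableOn_inv_add_mul_inv_add hrs (htj j hj).1).const_mul _
  have hintsum := integrable_finsetSum (Finset.range (n + 1)) hint
  have hterm : ∀ j ∈ Finset.range (n + 1),
      ∫ u in Set.Ioi (0 : ℝ), E⁻¹ * (((u : ℂ) + r)⁻¹ * ((u : ℂ) + t j)⁻¹) =
        -((log a - log w : ℝ) * S j + (2 * α * Complex.I) * (((n : ℝ) - j : ℝ) * S j)) := by
    intro j hj
    rw [integral_const_mul, integral_inv_add_mul_inv_add hrs (htj j hj).1 (hrt j), hrl,
      (htj j hj).2]
    have hden : E⁻¹ / (r - t j) = -S j := by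
      have : E * (r - t j) = -(a - w * E ^ 2 * (E ^ 2) ^ j) := by
        simp only [hr, ht]; field_simp; ring
      rw [div_eq_mul_inv, ← mul_inv, this, inv_neg]
    rw [mul_div_assoc', mul_div_right_comm, hden, ← hαM]
    push_cast; ring
  have hStot := hζ.sum_inv_sub (x := (a : ℂ)) (c := w * E ^ 2) (by
      rw [mul_pow, hζ.pow_eq_one, mul_one]
      intro h
      exact hpow.ne (by exact_mod_cast h))
  rw [mul_pow, hζ.pow_eq_one, mul_one] at hStot
  have hSre : ∑ j ∈ Finset.range (n + 1), S j =
      (((n + 1 : ℕ) : ℝ) * a ^ n / (a ^ (n + 1) - w ^ (n + 1)) : ℝ) := by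
    rw [hStot]; push_cast; simp
  have hSn : S n = ((a - w : ℝ)⁻¹ : ℝ) := by
    simp only [hS]
    rw [mul_assoc, ← pow_succ', hζ.pow_eq_one]; push_cast; simp
  have hweighted : ∑ j ∈ Finset.range (n + 1), ((n : ℝ) - j) * (S j).re =
      (n + 1) / 2 * (((n + 1 : ℕ) : ℝ) * a ^ n / (a ^ (n + 1) - w ^ (n + 1)) - (a - w)⁻¹) := by
    have h1 := congrArg Complex.re hSre
    rw [Finset.sum_range_succ, hSn, Complex.add_re, Complex.ofReal_re, Complex.ofReal_re,
      Complex.re_sum] at h1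
    have h2 := hζ.sum_mul_re_inv_sub a w
    rw [Finset.sum_range_succ, sub_self, zero_mul, add_zero]
    rw [← h1]
    simp only [hS] at h2 ⊢
    linarith
  refine ⟨IntegrableOn.congr_fun hintsum.im.neg (fun u hu => (hpoint u hu).symm)
    measurableSet_Ioi, ?_⟩
  rw [setIntegral_congr_fun measurableSet_Ioi hpoint, integral_neg]
  have him := integral_im hintsum
  simp only [RCLike.im_to_complex] at him
  rw [him, integral_finsetSum _ hint, Finset.sum_congr rfl hterm, Finset.sum_neg_distrib,
    Finset.sum_add_distrib, ← Finset.mul_sum, ← Finset.mul_sum, hSre, Complex.neg_im, neg_neg,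
    Complex.add_im, ← Complex.ofReal_mul, Complex.ofReal_im, zero_add]
  have hI : (2 * α * Complex.I * ∑ j ∈ Finset.range (n + 1), (((n : ℝ) - j : ℝ) * S j)).im =
      2 * α * ∑ j ∈ Finset.range (n + 1), ((n : ℝ) - j) * (S j).re := by
    rw [mul_assoc, ← Complex.ofReal_ofNat, ← Complex.ofReal_mul,
      Complex.im_ofReal_mul]
    simp [Complex.re_sum]
  rw [hI, hweighted, ← hαM, add_tsub_cancel_right]
  rw [← neg_sub w a, ← neg_sub (w ^ (n + 1)), inv_neg, div_neg]
  ring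

theorem laplace_laplace_eq_stieltjes {ρ : ℝ → ℝ} (hρm : Measurable ρ)
    (hρ : ∀ y > 0, 0 ≤ ρ y) {z : ℝ} (hz : 0 < z)
    (hint : IntegrableOn (fun y => ρ y / (z + y)) (Set.Ioi 0)) :
    IntegrableOn (fun x => ∫ y in Set.Ioi (0 : ℝ), exp (-(z + y) * x) * ρ y) (Set.Ioi 0) ∧
    ∫ x in Set.Ioi (0 : ℝ), ∫ y in Set.Ioi (0 : ℝ), exp (-(z + y) * x) * ρ y =
      ∫ y in Set.Ioi (0 : ℝ), ρ y / (z + y) := by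
  have hinner : ∀ y ∈ Set.Ioi (0 : ℝ),
      ∫ x in Set.Ioi (0 : ℝ), exp (-(z + y) * x) * ρ y = ρ y / (z + y) := by
    intro y hy
    have hy0 : (0 : ℝ) < y := hy
    rw [integral_mul_const, integral_exp_mul_Ioi (by linarith)]
    simp only [mul_zero, exp_zero, neg_div_neg_eq]
    ring
  have hprod : Integrable (Function.uncurry fun x y : ℝ => exp (-(z + y) * x) * ρ y)
      ((volume.restrict (Set.Ioi 0)).prod (volume.restrict (Set.Ioi 0))) := by
    rw [integrable_prod_iff' (by
      refine Measurable.aestronglyMeasurable ?_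
      unfold Function.uncurry
      fun_prop)]
    refine ⟨?_, ?_⟩
    · filter_upwards [ae_restrict_mem measurableSet_Ioi] with y hy
      have hy0 : (0 : ℝ) < y := hy
      have hneg : -(z + y) < 0 := by linarith
      simpa only [Function.uncurry] using
        (integrableOn_exp_mul_Ioi hneg 0).integrable.mul_const (ρ y)
    · refine IntegrableOn.congr_fun hint (fun y hy => ?_) measurableSet_Ioi
      simp only [Function.uncurry]
      rw [← hinner y hy]
      refine integral_congr_ae (.of_forall fun x => ?_)
      exact (Real.norm_of_nonneg (mul_nonneg (exp_pos _).le (hρ y hy))).symm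
  refine ⟨hprod.integral_prod_left, ?_⟩
  rw [integral_integral_swap hprod]
  exact setIntegral_congr_fun measurableSet_Ioi hinner

/-- The pdf of the geometric tempered stable innovation distribution, obtained by the
complex inversion formula, has Laplace transform `1/(1 + θ((s+λ)^β − λ^β))`. -/
theorem geometric_tempered_stable_innovation_pdf
    (m : ℕ) (hm : 2 ≤ m) (β lam θ s₀ : ℝ)
    (hβ : β = 1 / (m : ℝ)) (hlam : 0 < lam) (hθ : θ ∈ Set.Ioo (0 : ℝ) 1)
    (hpole : 1 < θ * lam ^ β)
    (hs₀ : s₀ = (lam ^ β - 1 / θ) ^ m)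
    (f : ℝ → ℝ)
    (hf : ∀ x > (0 : ℝ), f x =
      Real.exp ((s₀ - lam) * x) / (θ * β * s₀ ^ (β - 1)) +
        (1 / Real.pi) * ∫ y in Set.Ioi (0 : ℝ),
          θ * Real.exp (-x * (y + lam)) * y ^ β * Real.sin (Real.pi * β) /
            (1 + 2 * θ * (y ^ β * Real.cos (Real.pi * β) - lam ^ β) +
              θ ^ 2 * (y ^ (2 * β) - 2 * lam ^ β * y ^ β * Real.cos (Real.pi * β)
                + lam ^ (2 * β)))) :
    ∀ s > 0, ∫ x in Set.Ioi (0 : ℝ), Real.exp (-s * x) * f x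
      = 1 / (1 + θ * ((s + lam) ^ β - lam ^ β)) := by
  intro s hs
  have hθ0 : 0 < θ := hθ.1
  have hm0 : (0 : ℝ) < m := by positivity
  have hm1 : m ≠ 0 := by omega
  have hβ0 : 0 < β := by rw [hβ]; positivity
  have hπβ : π * β = π / m := by rw [hβ]; ring
  have hpowβ (u : ℝ) (hu : 0 ≤ u) : (u ^ m) ^ β = u := by
    rw [hβ, one_div]; exact Real.pow_rpow_inv_natCast hu hm1
  have hβpow (y : ℝ) (hy : 0 ≤ y) : (y ^ β) ^ m = y := by
    rw [hβ, one_div]; exact Real.rpow_inv_natCast_pow hy hm1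
  have htwo (y : ℝ) (hy : 0 ≤ y) : y ^ (2 * β) = (y ^ β) ^ 2 := by
    rw [mul_comm, Real.rpow_mul hy]; norm_num
  set a : ℝ := lam ^ β - 1 / θ with ha_def
  set z : ℝ := s + lam with hz_def
  have hz0 : 0 < z := by positivity
  set w : ℝ := z ^ β with hw_def
  have ha : 0 < a := by
    rw [ha_def, sub_pos, div_lt_iff₀ hθ0]; linarith
  have hL : lam ^ β = a + 1 / θ := by rw [ha_def]; ring
  have haw : a < w := by
    have h1 : lam ^ β < w := Real.rpow_lt_rpow hlam.le (by linarith) hβ0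
    have : 0 < 1 / θ := by positivity
    linarith
  have hwm : w ^ m = z := hβpow z hz0.le
  have hs₀z : s₀ < z := by
    rw [hs₀, ← hwm]; exact pow_lt_pow_left₀ haw ha.le hm1
  set ρ : ℝ → ℝ := fun y => θ * y ^ β * sin (π * β) /
    (1 + 2 * θ * (y ^ β * cos (π * β) - lam ^ β) +
      θ ^ 2 * (y ^ (2 * β) - 2 * lam ^ β * y ^ β * cos (π * β) + lam ^ (2 * β))) with hρ_def
  have hden (y : ℝ) (hy : 0 < y) : 1 + 2 * θ * (y ^ β * cos (π * β) - lam ^ β) +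
      θ ^ 2 * (y ^ (2 * β) - 2 * lam ^ β * y ^ β * cos (π * β) + lam ^ (2 * β)) =
      θ ^ 2 * ((y ^ β) ^ 2 - 2 * a * cos (π / m) * y ^ β + a ^ 2) := by
    rw [htwo y hy.le, htwo lam hlam.le, hL, hπβ]
    field_simp
    ring
  have hρ0 : ∀ y > 0, 0 ≤ ρ y := by
    intro y hy
    simp only [hρ_def]
    rw [hden y hy, hπβ]
    have hsin : 0 ≤ sin (π / m) := sin_nonneg_of_nonneg_of_le_pi (by positivity)
      (div_le_self pi_pos.le (by exact_mod_cast (by omega : 1 ≤ m)))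
    have hq : 0 ≤ (y ^ β) ^ 2 - 2 * a * cos (π / m) * y ^ β + a ^ 2 := by
      have h1 := sin_sq_add_cos_sq (π / m)
      have h2 : (y ^ β) ^ 2 - 2 * a * cos (π / m) * y ^ β + a ^ 2 =
        (y ^ β - a * cos (π / m)) ^ 2 + (a * sin (π / m)) ^ 2 := by
        linear_combination (-a ^ 2) * h1
      rw [h2]; positivity
    positivity
  have hρm : Measurable ρ := by
    simp only [hρ_def]; fun_prop
  obtain ⟨hGint, hG⟩ := integral_pow_div_quadratic_mul_pow_add_pow hm ha haw
  have hsubst : Set.EqOn (fun u : ℝ => (|(m : ℝ)| * u ^ ((m : ℝ) - 1)) •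
      (fun y => ρ y / (z + y)) (u ^ (m : ℝ)))
      (fun u => θ⁻¹ * (m * sin (π / m) * u ^ m /
        ((u ^ 2 - 2 * a * cos (π / m) * u + a ^ 2) * (u ^ m + w ^ m)))) (Set.Ioi 0) := by
    intro u hu
    have hu0 : (0 : ℝ) < u := hu
    have hpow : u ^ ((m : ℝ) - 1) * u = u ^ m := by
      rw [Real.rpow_sub_one hu0.ne', Real.rpow_natCast]; field_simp
    simp only [hρ_def, smul_eq_mul]
    rw [hden _ (by positivity), Real.rpow_natCast, hpowβ u hu0.le, hπβ, hwm,
      abs_of_pos hm0, add_comm z, div_div, mul_div_assoc', inv_mul_eq_div, div_div]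
    rw [show θ ^ 2 * (u ^ 2 - 2 * a * cos (π / m) * u + a ^ 2) * (u ^ m + z) =
      θ * ((u ^ 2 - 2 * a * cos (π / m) * u + a ^ 2) * (u ^ m + z) * θ) by ring]
    rw [show m * u ^ ((m : ℝ) - 1) * (θ * u * sin (π / m)) =
      θ * (m * sin (π / m) * (u ^ ((m : ℝ) - 1) * u)) by ring, mul_div_mul_left _ _ hθ0.ne', hpow]
  have hρint : IntegrableOn (fun y => ρ y / (z + y)) (Set.Ioi 0) :=
    (integrableOn_Ioi_comp_rpow_iff _ hm0.ne').1
      (IntegrableOn.congr_fun (hGint.const_mul θ⁻¹) hsubst.symm measurableSet_Ioi)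
  have hρval : ∫ y in Set.Ioi (0 : ℝ), ρ y / (z + y) =
      θ⁻¹ * (π * ((w - a)⁻¹ - m * a ^ (m - 1) / (w ^ m - a ^ m))) := by
    rw [← integral_comp_rpow_Ioi (fun y => ρ y / (z + y)) hm0.ne',
      setIntegral_congr_fun measurableSet_Ioi hsubst, integral_const_mul, hG]
  obtain ⟨hFint, hF⟩ := laplace_laplace_eq_stieltjes hρm hρ0 hz0 hρint
  have hfx : Set.EqOn (fun x => exp (-s * x) * f x)
      (fun x => (θ * β * s₀ ^ (β - 1))⁻¹ * exp ((s₀ - z) * x) +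
        (1 / π) * ∫ y in Set.Ioi (0 : ℝ), exp (-(z + y) * x) * ρ y) (Set.Ioi 0) := by
    intro x hx
    simp only
    rw [hf x hx, mul_add, mul_left_comm (exp _) (1 / π), ← integral_const_mul]
    congr 1
    · rw [show (s₀ - z) * x = -s * x + (s₀ - lam) * x by rw [hz_def]; ring, exp_add]
      ring
    · congr 1
      refine integral_congr_ae (.of_forall fun y => ?_)
      simp only [hρ_def]
      rw [show -(z + y) * x = -s * x + -x * (y + lam) by rw [hz_def]; ring, exp_add]
      ring
  have hres : (θ * β * s₀ ^ (β - 1))⁻¹ = θ⁻¹ * (m * a ^ (m - 1)) := by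
    have h1 : s₀ ^ (β - 1) = a / a ^ m := by
      rw [hs₀, Real.rpow_sub_one (by positivity), hpowβ a ha.le]
    have h2 : a ^ m = a ^ (m - 1) * a := (pow_sub_one_mul hm1 a).symm
    rw [h1, h2, hβ]
    field_simp
  rw [setIntegral_congr_fun measurableSet_Ioi hfx,
    integral_add ((integrableOn_exp_mul_Ioi (by linarith) 0).const_mul _) (hFint.const_mul _),
    integral_const_mul, integral_const_mul, hF, hρval, integral_exp_mul_Ioi (by linarith), hres,
    hL, hs₀, ← hwm]
  have hwa : w - a ≠ 0 := sub_ne_zero.2 haw.ne'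
  have hwa' : a ^ m - w ^ m ≠ 0 := sub_ne_zero.2 (pow_lt_pow_left₀ haw ha.le hm1).ne
  have hfin : 1 + θ * (w - (a + 1 / θ)) = θ * (w - a) := by field_simp; ring
  rw [hfin, ← neg_sub (a ^ m) (w ^ m)]
  simp only [mul_zero, exp_zero]
  field_simp
  ring
end

section
/- For every x > 0, (1/π) ∫_0^∞ e^{−xy} √y / (1 + y) dy = 1/√(πx) − e^x + e^x · Erf(√x), where Erf is the error function Erf(t) = (2/√π) ∫_0^t e^{−u²} du. -/
open Real MeasureTheory

/-- The error function `Erf(t) = (2/√π) ∫_0^t e^{−u²} du`. -/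
noncomputable def Erf (t : ℝ) : ℝ := (2 / Real.sqrt Real.pi) * ∫ u in (0 : ℝ)..t, Real.exp (-u ^ 2)

open Set Filter Topology

lemma integrableOn_exp_neg_mul_mul_sqrt {x : ℝ} (hx : 0 < x) :
    IntegrableOn (fun y : ℝ => exp (-x * y) * √y) (Ioi 0) := by
  refine (integrableOn_rpow_mul_exp_neg_mul_rpow (s := 1 / 2) (p := 1) (by norm_num) one_pos
    hx).congr_fun (fun y _ => ?_) measurableSet_Ioi
  simp only [rpow_one, sqrt_eq_rpow]
  ring

lemma integral_exp_neg_mul_mul_sqrt {x : ℝ} (hx : 0 < x) :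
    ∫ y in Ioi (0 : ℝ), exp (-x * y) * √y = √π / (2 * x * √x) := by
  have h := integral_rpow_mul_exp_neg_mul_Ioi (a := 1 / 2 + 1) (by norm_num) hx
  rw [Gamma_add_one (by norm_num), Gamma_one_half_eq, rpow_add (by positivity), rpow_one,
    ← sqrt_eq_rpow, sqrt_div zero_le_one, sqrt_one] at h
  calc _ = ∫ t in Ioi (0 : ℝ), t ^ ((1 / 2 + 1 : ℝ) - 1) * exp (-(x * t)) := by
        refine setIntegral_congr_fun measurableSet_Ioi fun y _ => ?_
        simp only [add_sub_cancel_right, sqrt_eq_rpow, neg_mul]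
        ring
    _ = _ := by
        rw [h]
        field_simp

lemma integrableOn_exp_neg_mul_mul_sqrt_div {x : ℝ} (hx : 0 < x) :
    IntegrableOn (fun y : ℝ => exp (-x * y) * √y / (1 + y)) (Ioi 0) := by
  refine (integrableOn_exp_neg_mul_mul_sqrt hx).mono'
    (Measurable.aestronglyMeasurable (by fun_prop)) ?_
  filter_upwards [ae_restrict_mem measurableSet_Ioi] with y hy
  have hy : 0 < y := hy
  rw [norm_of_nonneg (by positivity)]
  exact div_le_self (by positivity) (by linarith)

lemma hasDerivAt_integral_exp_neg_mul_mul_sqrt_div {x : ℝ} (hx : 0 < x) :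
    HasDerivAt (fun t : ℝ => ∫ y in Ioi (0 : ℝ), exp (-t * y) * √y / (1 + y))
      ((∫ y in Ioi (0 : ℝ), exp (-x * y) * √y / (1 + y)) - √π / (2 * x * √x)) x := by
  have h := (hasDerivAt_integral_of_dominated_loc_of_deriv_le
    (μ := volume.restrict (Ioi (0 : ℝ)))
    (F := fun t y : ℝ => exp (-t * y) * √y / (1 + y))
    (F' := fun t y : ℝ => exp (-t * y) * √y / (1 + y) - exp (-t * y) * √y)
    (bound := fun y => exp (-(x / 2) * y) * √y) (Ioi_mem_nhds (half_lt_self hx))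
    (Eventually.of_forall fun t => Measurable.aestronglyMeasurable (by fun_prop))
    (integrableOn_exp_neg_mul_mul_sqrt_div hx) (by fun_prop) ?_
    (integrableOn_exp_neg_mul_mul_sqrt (half_pos hx)) ?_).2
  · rwa [integral_sub (integrableOn_exp_neg_mul_mul_sqrt_div hx)
      (integrableOn_exp_neg_mul_mul_sqrt hx), integral_exp_neg_mul_mul_sqrt hx] at h
  · filter_upwards [ae_restrict_mem measurableSet_Ioi] with y hy t ht
    have hy : 0 < y := hy
    have ht : x / 2 < t := ht
    have hle : exp (-t * y) * √y / (1 + y) ≤ exp (-t * y) * √y :=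
      div_le_self (by positivity) (by linarith)
    have h0 : 0 ≤ exp (-t * y) * √y / (1 + y) := by positivity
    rw [norm_eq_abs, abs_of_nonpos (by linarith)]
    have : exp (-t * y) * √y ≤ exp (-(x / 2) * y) * √y := by gcongr
    linarith
  · filter_upwards [ae_restrict_mem measurableSet_Ioi] with y hy t _
    have hy : 0 < y := hy
    refine ((((hasDerivAt_neg t).mul_const y).exp.mul_const √y).div_const (1 + y)).congr_deriv ?_
    field_simp
    ring

lemma hasDerivAt_Erf (t : ℝ) : HasDerivAt Erf (2 / √π * exp (-t ^ 2)) t := by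
  have hc : Continuous fun u : ℝ => exp (-u ^ 2) := by fun_prop
  exact (hc.integral_hasStrictDerivAt 0 t).hasDerivAt.const_mul _

lemma tendsto_Erf_atTop : Tendsto Erf atTop (𝓝 1) := by
  have h := integral_gaussian_Ioi 1
  have hi : IntegrableOn (fun u : ℝ => exp (-u ^ 2)) (Ioi 0) := by
    simpa using (integrable_exp_neg_mul_sq one_pos).integrableOn (s := Ioi (0 : ℝ))
  have ht := (intervalIntegral_tendsto_integral_Ioi 0 hi tendsto_id).const_mul (2 / √π)
  simp only [neg_mul, one_mul, div_one] at h
  rwa [h, div_mul_div_cancel₀ (by positivity), div_self two_ne_zero] at ht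

lemma hasDerivAt_exp_neg_mul_branch_cut_sub {x : ℝ} (hx : 0 < x) :
    HasDerivAt (fun t : ℝ => exp (-t) *
        ((1 / π) * ∫ y in Ioi (0 : ℝ), exp (-t * y) * √y / (1 + y))
        - exp (-t) * (1 / √(π * t)) + 1 - Erf √t) 0 x := by
  have hE := (hasDerivAt_Erf √x).comp x (hasDerivAt_sqrt hx.ne')
  have hexp := (hasDerivAt_neg x).exp
  have hF := (hasDerivAt_integral_exp_neg_mul_mul_sqrt_div hx).const_mul (1 / π)
  have hr : HasDerivAt (fun t : ℝ => 1 / √(π * t)) (-(1 / (2 * √π * x * √x))) x := by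
    simp only [sqrt_mul pi_nonneg, one_div]
    refine (((hasDerivAt_sqrt hx.ne').const_mul √π).fun_inv (by positivity)).congr_deriv ?_
    rw [mul_pow, sq_sqrt hx.le]
    field_simp
  refine ((((hexp.mul hF).sub (hexp.mul hr)).add_const 1).sub hE).congr_deriv ?_
  rw [sqrt_mul pi_nonneg, sq_sqrt hx.le]
  field_simp
  linear_combination -exp (-x) * sq_sqrt pi_nonneg

lemma tendsto_exp_neg_mul_branch_cut_sub :
    Tendsto (fun t : ℝ => exp (-t) *
        ((1 / π) * ∫ y in Ioi (0 : ℝ), exp (-t * y) * √y / (1 + y))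
        - exp (-t) * (1 / √(π * t)) + 1 - Erf √t) atTop (𝓝 0) := by
  have hexp : Tendsto (fun t : ℝ => exp (-t)) atTop (𝓝 0) := tendsto_exp_neg_atTop_nhds_zero
  have hF : Tendsto (fun t : ℝ => exp (-t) *
      ((1 / π) * ∫ y in Ioi (0 : ℝ), exp (-t * y) * √y / (1 + y))) atTop (𝓝 0) := by
    have hb := hexp.mul_const
      ((1 / π) * ∫ y in Ioi (0 : ℝ), exp (-1 * y) * √y / (1 + y))
    rw [zero_mul] at hb
    refine squeeze_zero' (Eventually.of_forall fun t => ?_) ?_ hb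
    · have : 0 ≤ ∫ y in Ioi (0 : ℝ), exp (-t * y) * √y / (1 + y) :=
        setIntegral_nonneg measurableSet_Ioi fun y (hy : 0 < y) => by positivity
      positivity
    · filter_upwards [eventually_ge_atTop 1] with t ht
      have : ∫ y in Ioi (0 : ℝ), exp (-t * y) * √y / (1 + y) ≤
          ∫ y in Ioi (0 : ℝ), exp (-1 * y) * √y / (1 + y) :=
        setIntegral_mono_on (integrableOn_exp_neg_mul_mul_sqrt_div (by linarith))
          (integrableOn_exp_neg_mul_mul_sqrt_div one_pos) measurableSet_Ioi
          fun y (hy : 0 < y) => by gcongr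
      gcongr
  have hr : Tendsto (fun t : ℝ => 1 / √(π * t)) atTop (𝓝 0) := by
    simp only [one_div]
    exact (tendsto_sqrt_atTop.comp (tendsto_id.const_mul_atTop pi_pos)).inv_tendsto_atTop
  simpa using ((hF.sub (hexp.mul hr)).add_const 1).sub (tendsto_Erf_atTop.comp tendsto_sqrt_atTop)

/-- Branch-cut integral identity for the Mittag-Leffler distribution with index `1/2`:
`(1/π) ∫_0^∞ e^{−xy} √y/(1+y) dy = 1/√(πx) − e^x + e^x Erf(√x)` for `x > 0`. -/
theorem branch_cut_integral_half :
    ∀ x > (0 : ℝ),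
      (1 / Real.pi) * ∫ y in Set.Ioi (0 : ℝ), Real.exp (-x * y) * Real.sqrt y / (1 + y)
        = 1 / Real.sqrt (Real.pi * x) - Real.exp x + Real.exp x * Erf (Real.sqrt x) := by
  intro x hx
  have hzero := tendsto_nhds_unique (tendsto_exp_neg_mul_branch_cut_sub.congr' <| by
    filter_upwards [eventually_gt_atTop 0] with t ht
    exact isOpen_Ioi.is_const_of_deriv_eq_zero isPreconnected_Ioi
      (fun s hs => (hasDerivAt_exp_neg_mul_branch_cut_sub hs).differentiableAt
        |>.differentiableWithinAt)
      (fun s hs => (hasDerivAt_exp_neg_mul_branch_cut_sub hs).deriv)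
      (mem_Ioi.2 ht) (mem_Ioi.2 hx)) tendsto_const_nhds
  have hmul : exp x * exp (-x) = 1 := by rw [← exp_add, add_neg_cancel, exp_zero]
  linear_combination (-exp x) * hzero - ((1 / π) *
    (∫ y in Ioi (0 : ℝ), exp (-x * y) * √y / (1 + y)) - 1 / √(π * x)) * hmul
end

section
/- Let α > 0, β > 0 and θ ∈ (0,1), and set s₀ = β(e^{−1/(αθ)} − 1), so that s₀ ∈ (−β, 0) and 1 + αθ log((s₀+β)/β) = 0. Define f : (0,∞) → ℝ by f(x) = ((s₀ + β)/(αθ)) e^{s₀ x} + e^{−βx} ∫_0^∞ αθ e^{−xy} / [ (1 + αθ log(y/β))² + π² α² θ² ] dy. Then for every s > 0, ∫_0^∞ e^{−sx} f(x) dx = 1/(1 + αθ log((s+β)/β)). -/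
open Real MeasureTheory

open Filter Topology

/-- Removing the poles at `0` and `L` of `1 / (v (1 - exp (L - v)))` leaves a function that is
holomorphic on the strip `|Im v| < 2π`. -/
lemma exists_differentiableOn_strip_eq (L : ℝ) (hL : L ≠ 0) :
    ∃ Q : ℂ → ℂ, DifferentiableOn ℂ Q (Complex.im ⁻¹' Set.Ioo (-(2 * π)) (2 * π)) ∧
      ∀ v : ℂ, v ∈ Complex.im ⁻¹' Set.Ioo (-(2 * π)) (2 * π) → v ≠ 0 → v ≠ L →
        Q v = 1 / (1 - Complex.exp (L - v)) / v - (1 / (1 - Real.exp L) : ℝ) / v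
          - (1 / L : ℝ) / (v - L) := by
  set S : Set ℂ := Complex.im ⁻¹' Set.Ioo (-(2 * π)) (2 * π) with hS
  have hSo : IsOpen S := isOpen_Ioo.preimage Complex.continuous_im
  have h0S : S ∈ 𝓝 (0 : ℂ) := hSo.mem_nhds (by simp [hS, Real.pi_pos])
  set E : ℂ → ℂ := dslope (fun w => 1 - Complex.exp (-w)) 0 with hE
  have hEd : DifferentiableOn ℂ E S :=
    (Complex.differentiableOn_dslope h0S).2 (by fun_prop)
  have hEv : ∀ w, w ≠ 0 → E w = (1 - Complex.exp (-w)) / w := by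
    intro w hw
    rw [hE, dslope_of_ne _ hw, slope_def_field]
    simp
  have hE0 : E 0 = 1 := by
    rw [hE, dslope_same]
    have h : HasDerivAt (fun w : ℂ => 1 - Complex.exp (-w)) (-(Complex.exp (-0) * -1)) 0 :=
      ((hasDerivAt_neg (0 : ℂ)).cexp).const_sub 1
    simpa using h.deriv
  have hone : ∀ w ∈ S, w ≠ 0 → 1 - Complex.exp (-w) ≠ 0 := by
    intro w hw hw0 h
    obtain ⟨n, hn⟩ := Complex.exp_eq_one_iff.1 (sub_eq_zero.1 h).symm
    have him : -w.im = n * (2 * π) := by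
      have := congrArg Complex.im hn
      simpa using this
    have hw' : -(2 * π) < w.im ∧ w.im < 2 * π := hw
    have hpi := Real.pi_pos
    have h1 : (n : ℝ) < 1 := by nlinarith
    have h2 : (-1 : ℝ) < n := by nlinarith
    have hn0 : n = 0 := by
      have h1' : n < 1 := by exact_mod_cast h1
      have h2' : -1 < n := by exact_mod_cast h2
      omega
    apply hw0
    simpa [hn0] using hn
  have hEne : ∀ w ∈ S, E w ≠ 0 := by
    intro w hw
    by_cases hw0 : w = 0
    · simp [hw0, hE0]
    · rw [hEv w hw0]
      exact div_ne_zero (hone w hw hw0) hw0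
  set K : ℂ → ℂ := dslope (fun w => 1 / E w) 0 with hK
  have hKd : DifferentiableOn ℂ K S :=
    (Complex.differentiableOn_dslope h0S).2
      (DifferentiableOn.div (differentiableOn_const _) hEd hEne)
  have hKv : ∀ w, w ≠ 0 → K w = 1 / (1 - Complex.exp (-w)) - 1 / w := by
    intro w hw
    rw [hK, dslope_of_ne _ hw, slope_def_field, hE0, hEv w hw]
    simp only [sub_zero, one_div, inv_div, inv_one]
    field_simp
  have hsub : ∀ v ∈ S, v - L ∈ S := by
    intro v hv
    simpa [hS] using hv
  refine ⟨dslope (fun v => K (v - L)) 0, ?_, ?_⟩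
  · refine (Complex.differentiableOn_dslope h0S).2 ?_
    exact hKd.comp (by fun_prop) hsub
  · intro v hv hv0 hvL
    have hLc : (L : ℂ) ≠ 0 := by exact_mod_cast hL
    have hvL' : v - L ≠ 0 := sub_ne_zero.2 hvL
    rw [dslope_of_ne _ hv0, slope_def_field, hKv _ hvL', hKv _ (by simpa using hL)]
    have h1 : 1 - Complex.exp (L - v) ≠ 0 := by
      have := hone _ (hsub v hv) hvL'
      rwa [neg_sub] at this
    have h2 : (1 : ℂ) - Complex.exp L ≠ 0 := by
      have := hone (-L) (by simp [hS, Real.pi_pos]) (by simpa using hL)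
      rwa [neg_neg] at this
    push_cast
    simp only [neg_sub, zero_sub, neg_neg, sub_zero]
    generalize Complex.exp (L - v) = e at *
    generalize Complex.exp L = e' at *
    field_simp
    ring

lemma tendsto_intervalIntegral_vertical_zero (Q : ℂ → ℂ) (B : ℝ → ℝ) (x : ℝ → ℝ)
    (hB : Tendsto B atTop (𝓝 0)) (a b : ℝ)
    (hQ : ∀ᶠ R in atTop, ∀ y ∈ Set.uIoc a b, ‖Q (x R + y * Complex.I)‖ ≤ B R) :
    Tendsto (fun R : ℝ => ∫ y in a..b, Q (x R + y * Complex.I)) atTop (𝓝 0) := by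
  refine squeeze_zero_norm' (a := fun R => B R * |b - a|) ?_ (by simpa using hB.mul_const _)
  filter_upwards [hQ] with R hR
  exact intervalIntegral.norm_integral_le_of_norm_le_const hR

lemma one_half_le_norm_one_sub_exp (w : ℂ) (hw : 1 ≤ |w.re|) :
    1 / 2 ≤ ‖1 - Complex.exp w‖ := by
  have he := Complex.norm_exp w
  rcases le_abs'.1 hw with h | h
  · have h1 : Real.exp w.re ≤ 1 / 2 := by
      refine (Real.exp_le_exp.2 h).trans ?_
      have h2 : (2 : ℝ) ≤ Real.exp 1 := by linarith [Real.add_one_le_exp (1 : ℝ)]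
      rw [Real.exp_neg, inv_eq_one_div]
      exact one_div_le_one_div_of_le two_pos h2
    have h3 := norm_sub_norm_le (1 : ℂ) (Complex.exp w)
    rw [norm_one, he] at h3
    linarith
  · have h1 : 2 ≤ Real.exp w.re := by linarith [Real.add_one_le_exp w.re]
    have h3 := norm_sub_norm_le (Complex.exp w) (1 : ℂ)
    rw [norm_one, he, norm_sub_rev] at h3
    linarith

lemma norm_sub_poles_le (L a b R : ℝ) (hR : |L| + 1 ≤ R) (v : ℂ) (hv : |v.re| = R) :
    ‖1 / (1 - Complex.exp (L - v)) / v - (a : ℂ) / v - (b : ℂ) / (v - L)‖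
      ≤ (2 + |a|) / R + |b| / (R - |L|) := by
  have hRpos : 0 < R := by linarith [abs_nonneg L]
  have hRL : 0 < R - |L| := by linarith
  have hv1 : R ≤ ‖v‖ := hv ▸ Complex.abs_re_le_norm v
  have hre : R - |L| ≤ |(v - L).re| := by
    rw [Complex.sub_re, Complex.ofReal_re, ← hv]
    exact abs_sub_abs_le_abs_sub _ _
  have hv2 : R - |L| ≤ ‖v - L‖ := hre.trans (Complex.abs_re_le_norm _)
  have h1 : 1 / 2 ≤ ‖1 - Complex.exp (L - v)‖ := by
    apply one_half_le_norm_one_sub_exp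
    rw [← neg_sub, Complex.neg_re, abs_neg]
    linarith
  have h2 : ‖1 / (1 - Complex.exp (L - v))‖ ≤ 2 := by
    rw [norm_div, norm_one]
    simpa using one_div_le_one_div_of_le one_half_pos h1
  rw [← sub_div]
  refine (norm_sub_le _ _).trans (add_le_add ?_ ?_)
  · rw [norm_div]
    refine div_le_div₀ (by positivity) ((norm_sub_le _ _).trans (add_le_add h2 ?_)) hRpos hv1
    simp
  · rw [norm_div]
    exact div_le_div₀ (by positivity) (by simp) hRL hv2

lemma integrable_inv_sq_add_pi_sq : Integrable fun u : ℝ => (u ^ 2 + π ^ 2)⁻¹ := by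
  have h := (integrable_inv_one_add_sq.comp_div Real.pi_ne_zero).const_mul (π ^ 2)⁻¹
  refine h.congr (Eventually.of_forall fun u => ?_)
  have := Real.pi_ne_zero
  simp only
  rw [← mul_inv]
  congr 1
  field_simp
  ring

lemma integral_inv_sq_add_pi_sq : ∫ u : ℝ, (u ^ 2 + π ^ 2)⁻¹ = 1 := by
  have hpi := Real.pi_pos
  have h := Measure.integral_comp_div (fun x : ℝ => (1 + x ^ 2)⁻¹) π
  rw [integral_univ_inv_one_add_sq, abs_of_pos hpi, smul_eq_mul] at h
  have h2 : ∀ u : ℝ, (u ^ 2 + π ^ 2)⁻¹ = (π ^ 2)⁻¹ * (1 + (u / π) ^ 2)⁻¹ := by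
    intro u
    rw [← mul_inv]
    congr 1
    field_simp
    ring
  simp_rw [h2]
  rw [integral_const_mul, h]
  field_simp

lemma integrable_inv_sq_add_pi_sq_mul (L : ℝ) :
    Integrable fun u : ℝ => (u ^ 2 + π ^ 2)⁻¹ * (1 + Real.exp (L - u))⁻¹ := by
  refine integrable_inv_sq_add_pi_sq.mul_bdd (c := 1) ?_ (Eventually.of_forall fun u => ?_)
  · exact (by fun_prop : Measurable fun u : ℝ => (1 + Real.exp (L - u))⁻¹).aestronglyMeasurable
  · rw [Real.norm_of_nonneg (by positivity)]
    exact inv_le_one_of_one_le₀ (by linarith [Real.exp_pos (L - u)])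

/-- The contour integral of `1 / (v (1 - exp (L - v)))` around the strip `|Im v| < π`, whose only
poles are `0` and `L`, in real form. -/
lemma integral_inv_sq_add_pi_sq_mul (L : ℝ) (hL : L ≠ 0) :
    ∫ u : ℝ, (u ^ 2 + π ^ 2)⁻¹ * (1 + Real.exp (L - u))⁻¹
      = 1 / (1 - Real.exp L) + 1 / L := by
  obtain ⟨Q, hQd, hQ⟩ := exists_differentiableOn_strip_eq L hL
  set a : ℝ := 1 / (1 - Real.exp L)
  set b : ℝ := 1 / L
  have hpi := Real.pi_pos
  set q : ℝ → ℝ := fun u => (u ^ 2 + π ^ 2)⁻¹ * (1 + Real.exp (L - u))⁻¹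
    - a * (u ^ 2 + π ^ 2)⁻¹ - b * ((u - L) ^ 2 + π ^ 2)⁻¹ with hq
  have hi1 := integrable_inv_sq_add_pi_sq_mul L
  have hi2 := integrable_inv_sq_add_pi_sq.const_mul a
  have hi3 := (integrable_inv_sq_add_pi_sq.comp_sub_right L).const_mul b
  have hqi : Integrable q := (hi1.sub hi2).sub hi3
  have hqint : ∫ u, q u = (∫ u : ℝ, (u ^ 2 + π ^ 2)⁻¹ * (1 + Real.exp (L - u))⁻¹) - a - b := by
    have h1 := integral_sub (hi1.sub hi2) hi3
    have h2 := integral_sub hi1 hi2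
    simp only [Pi.sub_apply] at h1
    rw [hq, h1, h2, integral_const_mul, integral_const_mul, integral_sub_right_eq_self (fun u : ℝ => (u ^ 2 + π ^ 2)⁻¹),
      integral_inv_sq_add_pi_sq]
    ring
  have hjump : ∀ u : ℝ, Q (u + (-π : ℝ) * Complex.I) - Q (u + (π : ℝ) * Complex.I)
      = 2 * π * Complex.I * (q u : ℂ) := by
    intro u
    have hm : ∀ t : ℝ, t ≠ 0 → t ∈ Set.Ioo (-(2 * π)) (2 * π) →
        Q (u + t * Complex.I) = 1 / (1 - Complex.exp (L - (u + t * Complex.I)))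
          / (u + t * Complex.I) - a / (u + t * Complex.I) - b / (u + t * Complex.I - L) := by
      intro t ht0 ht
      refine hQ _ (by simpa using ht) (fun h => ht0 ?_) (fun h => ht0 ?_)
      · simpa using congrArg Complex.im h
      · simpa using congrArg Complex.im h
    rw [hm _ (by linarith) ⟨by linarith, by linarith⟩, hm _ hpi.ne' ⟨by linarith, by linarith⟩]
    have e1 : Complex.exp (L - (u + (-π : ℝ) * Complex.I)) = -Complex.exp (L - u) := by
      rw [show (L : ℂ) - (u + (-π : ℝ) * Complex.I) = (L - u) + π * Complex.I by push_cast; ring,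
        Complex.exp_add, Complex.exp_pi_mul_I]
      ring
    have e2 : Complex.exp (L - (u + (π : ℝ) * Complex.I)) = -Complex.exp (L - u) := by
      rw [show (L : ℂ) - (u + (π : ℝ) * Complex.I) = (L - u) - π * Complex.I by ring,
        Complex.exp_sub, Complex.exp_pi_mul_I]
      ring
    rw [e1, e2]
    have hpart : ∀ x : ℝ, 1 / ((x : ℂ) + (-π : ℝ) * Complex.I) - 1 / ((x : ℂ) + π * Complex.I)
        = 2 * π * Complex.I * (((x ^ 2 + π ^ 2)⁻¹ : ℝ) : ℂ) := by
      intro x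
      have n1 : (x : ℂ) + (-π : ℝ) * Complex.I ≠ 0 := fun h => hpi.ne' (by
        simpa using congrArg Complex.im h)
      have n2 : (x : ℂ) + π * Complex.I ≠ 0 := fun h => hpi.ne' (by
        simpa using congrArg Complex.im h)
      have n4 : (x : ℂ) ^ 2 + π ^ 2 = (x + (-π : ℝ) * Complex.I) * (x + π * Complex.I) := by
        push_cast
        linear_combination ((π : ℂ) ^ 2) * Complex.I_sq
      simp only [Complex.ofReal_neg, neg_mul, ← sub_eq_add_neg] at n1 n4 ⊢
      push_cast
      rw [n4]
      field_simp
      ring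
    have p1 := hpart u
    have p2 := hpart (u - L)
    have hr : (q u : ℂ) = (((u ^ 2 + π ^ 2)⁻¹ : ℝ) : ℂ) * (1 - -Complex.exp (L - u))⁻¹
        - a * (((u ^ 2 + π ^ 2)⁻¹ : ℝ) : ℂ) - b * ((((u - L) ^ 2 + π ^ 2)⁻¹ : ℝ) : ℂ) := by
      simp only [hq]
      push_cast
      ring
    have s1 : ∀ t : ℂ, (u : ℂ) + t - L = ((u - L : ℝ) : ℂ) + t := by
      intro t
      push_cast
      ring
    rw [hr, s1, s1]
    linear_combination ((1 - -Complex.exp (L - u))⁻¹ - a) * p1 - b * p2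
  have hbd : ∀ x : ℝ → ℝ, (∀ R, 0 < R → |x R| = R) →
      Tendsto (fun R : ℝ => ∫ y in (-π)..π, Q (x R + y * Complex.I)) atTop (𝓝 0) := by
    intro x hx
    have h1 : Tendsto (fun R : ℝ => (2 + |a|) / R) atTop (𝓝 0) :=
      tendsto_const_nhds.div_atTop tendsto_id
    have h2 : Tendsto (fun R : ℝ => |b| / (R - |L|)) atTop (𝓝 0) :=
      tendsto_const_nhds.div_atTop (tendsto_atTop_add_const_right _ _ tendsto_id)
    refine tendsto_intervalIntegral_vertical_zero Q
      (fun R => (2 + |a|) / R + |b| / (R - |L|)) x (by simpa using h1.add h2) _ _ ?_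
    filter_upwards [eventually_ge_atTop (|L| + 1)] with R hR y hy
    rw [Set.uIoc_of_le (by linarith)] at hy
    have hx' : |x R| = R := hx R (by linarith [abs_nonneg L])
    rw [hQ]
    · exact norm_sub_poles_le L a b R hR _ (by simpa using hx')
    · simpa using (⟨by linarith [hy.1], by linarith [hy.2]⟩ : -(2 * π) < y ∧ y < 2 * π)
    · intro h
      have h3 : x R = 0 := by simpa using congrArg Complex.re h
      rw [h3, abs_zero] at hx'
      linarith [abs_nonneg L]
    · intro h
      have h3 : x R = L := by simpa using congrArg Complex.re h
      rw [h3] at hx'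
      linarith
  have hlim : Tendsto (fun R : ℝ => ∫ u in (-R)..R, 2 * π * Complex.I * (q u : ℂ)) atTop
      (𝓝 (∫ u, 2 * π * Complex.I * (q u : ℂ))) :=
    intervalIntegral_tendsto_integral (hqi.ofReal.const_mul _) tendsto_neg_atTop_atBot tendsto_id
  have hzero : Tendsto (fun R : ℝ => ∫ u in (-R)..R, 2 * π * Complex.I * (q u : ℂ)) atTop
      (𝓝 0) := by
    have hv1 := hbd (fun R => R) fun R hR => abs_of_pos hR
    have hv2 := hbd (fun R => -R) fun R hR => by rw [abs_neg, abs_of_pos hR]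
    have hv := (hv2.const_mul Complex.I).sub (hv1.const_mul Complex.I)
    rw [mul_zero, sub_zero] at hv
    refine hv.congr fun R => ?_
    have hcont : ∀ t ∈ Set.Ioo (-(2 * π)) (2 * π), Continuous fun u : ℝ => Q (u + t * Complex.I) :=
      fun t ht => hQd.continuousOn.comp_continuous (by fun_prop) fun u => by simpa using ht
    have hrect := Complex.integral_boundary_rect_eq_zero_of_differentiableOn Q
      ⟨-R, -π⟩ ⟨R, π⟩ (hQd.mono fun v hv => by
        have h := (Complex.mem_reProdIm.1 hv).2
        rw [Set.uIcc_of_le (by simpa using (by linarith : -π ≤ π))] at h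
        exact ⟨by linarith [h.1], by linarith [h.2]⟩)
    simp only [smul_eq_mul] at hrect
    rw [← intervalIntegral.integral_sub
      ((hcont (-π) ⟨by linarith, by linarith⟩).intervalIntegrable _ _)
      ((hcont π ⟨by linarith, by linarith⟩).intervalIntegrable _ _)] at hrect
    simp only [hjump] at hrect
    linear_combination -hrect
  have heq := tendsto_nhds_unique hlim hzero
  rw [integral_const_mul, integral_complex_ofReal, mul_eq_zero] at heq
  have hfin : ∫ u, q u = 0 := by
    rcases heq with h | h
    · simp [hpi.ne'] at h
    · exact_mod_cast h
  linarith

/-- The Laplace transform of a Laplace transform is a Stieltjes transform. -/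
lemma integral_exp_mul_laplace_eq_stieltjes (k : ℝ → ℝ) (hkm : Measurable k) (z : ℝ) (hz : 0 < z)
    (hk : IntegrableOn (fun y => k y / (z + y)) (Set.Ioi 0)) :
    IntegrableOn (fun x => Real.exp (-z * x) * ∫ y in Set.Ioi (0 : ℝ), k y * Real.exp (-x * y))
        (Set.Ioi 0) ∧
      ∫ x in Set.Ioi (0 : ℝ), Real.exp (-z * x) * ∫ y in Set.Ioi (0 : ℝ), k y * Real.exp (-x * y)
        = ∫ y in Set.Ioi (0 : ℝ), k y / (z + y) := by
  set F : ℝ → ℝ → ℝ := fun x y => k y * Real.exp (-(z + y) * x) with hF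
  have hFe : ∀ x, Real.exp (-z * x) * ∫ y in Set.Ioi (0 : ℝ), k y * Real.exp (-x * y)
      = ∫ y in Set.Ioi (0 : ℝ), F x y := by
    intro x
    rw [← integral_const_mul]
    congr 1 with y
    rw [hF, mul_left_comm, ← Real.exp_add]
    ring_nf
  have hFm : Measurable (Function.uncurry F) := by
    simp only [hF, Function.uncurry_def]
    fun_prop
  have hexp : ∀ y ∈ Set.Ioi (0 : ℝ),
      ∫ x in Set.Ioi (0 : ℝ), Real.exp (-(z + y) * x) = 1 / (z + y) := by
    intro y hy
    have hy' : 0 < y := hy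
    rw [integral_exp_mul_Ioi (by linarith)]
    rw [mul_zero, Real.exp_zero, neg_div_neg_eq]
  have hFi : Integrable (Function.uncurry F)
      ((volume.restrict (Set.Ioi 0)).prod (volume.restrict (Set.Ioi 0))) := by
    rw [integrable_prod_iff' hFm.aestronglyMeasurable]
    constructor
    · filter_upwards [ae_restrict_mem measurableSet_Ioi] with y hy
      have hy' : 0 < y := hy
      exact (integrableOn_exp_mul_Ioi (by linarith : -(z + y) < 0) 0).const_mul (k y)
    · refine hk.norm.congr ?_
      filter_upwards [ae_restrict_mem measurableSet_Ioi] with y hy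
      have hy' : 0 < y := hy
      simp only [hF, Function.uncurry_apply_pair, norm_mul, Real.norm_eq_abs, Real.abs_exp]
      rw [integral_const_mul, hexp y hy, abs_div, abs_of_pos (by linarith : 0 < z + y),
        mul_one_div]
  simp_rw [hFe]
  refine ⟨hFi.integral_prod_left, ?_⟩
  rw [integral_integral_swap hFi]
  refine setIntegral_congr_fun measurableSet_Ioi fun y hy => ?_
  simp only [hF]
  rw [integral_const_mul, hexp y hy, mul_one_div]

lemma integral_log_kernel_div_add (c β z : ℝ) (hc : 0 < c) (hβ : 0 < β) (hz : β < z) :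
    IntegrableOn (fun y => c / ((1 + c * Real.log (y / β)) ^ 2 + π ^ 2 * c ^ 2) / (z + y))
        (Set.Ioi 0) ∧
      ∫ y in Set.Ioi (0 : ℝ), c / ((1 + c * Real.log (y / β)) ^ 2 + π ^ 2 * c ^ 2) / (z + y)
        = 1 / (1 + c * Real.log (z / β))
          - β * Real.exp (-1 / c) / c / (z - β * Real.exp (-1 / c)) := by
  set w : ℝ := β * Real.exp (-1 / c) with hw
  have hw0 : 0 < w := by positivity
  have hwβ : w < β := by
    have : Real.exp (-1 / c) < 1 := Real.exp_lt_one_iff.2 (div_neg_of_neg_of_pos (by norm_num) hc)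
    rw [hw]
    nlinarith
  have hz0 : 0 < z := hβ.trans hz
  set L : ℝ := Real.log (z / w) with hL
  have hexpL : Real.exp L = z / w := Real.exp_log (by positivity)
  have hLpos : 0 < L := Real.log_pos ((one_lt_div hw0).2 (hwβ.trans hz))
  have hcL : 1 + c * Real.log (z / β) = c * L := by
    rw [hL, hw, ← div_div, Real.log_div (by positivity) (Real.exp_ne_zero _), Real.log_exp]
    field_simp
    ring
  set g : ℝ → ℝ :=
    fun y => c / ((1 + c * Real.log (y / β)) ^ 2 + π ^ 2 * c ^ 2) / (z + y) with hg
  have himg : (fun u : ℝ => w * Real.exp u) '' Set.univ = Set.Ioi 0 := by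
    ext y
    simp only [Set.image_univ, Set.mem_range, Set.mem_Ioi]
    constructor
    · rintro ⟨u, rfl⟩
      positivity
    · intro hy
      refine ⟨Real.log (y / w), ?_⟩
      rw [Real.exp_log (by positivity)]
      field_simp
  have hderiv : ∀ u ∈ (Set.univ : Set ℝ),
      HasDerivWithinAt (fun u : ℝ => w * Real.exp u) (w * Real.exp u) Set.univ u :=
    fun u _ => ((Real.hasDerivAt_exp u).const_mul w).hasDerivWithinAt
  have hinj : Set.InjOn (fun u : ℝ => w * Real.exp u) Set.univ := fun u _ v _ h =>
    Real.exp_injective (mul_left_cancel₀ hw0.ne' h)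
  have hpull : ∀ u : ℝ, |w * Real.exp u| • g (w * Real.exp u)
      = c⁻¹ * ((u ^ 2 + π ^ 2)⁻¹ * (1 + Real.exp (L - u))⁻¹) := by
    intro u
    have hlog : 1 + c * Real.log (w * Real.exp u / β) = c * u := by
      rw [hw, mul_assoc, ← Real.exp_add, mul_div_cancel_left₀ _ hβ.ne', Real.log_exp]
      field_simp
      ring
    have hu := Real.exp_pos u
    have hpi : 0 < u ^ 2 + π ^ 2 := by positivity
    rw [hg]
    simp only
    rw [hlog, smul_eq_mul, abs_of_pos (by positivity), Real.exp_sub, hexpL,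
      show (c * u) ^ 2 + π ^ 2 * c ^ 2 = c ^ 2 * (u ^ 2 + π ^ 2) by ring]
    generalize u ^ 2 + π ^ 2 = d at *
    field_simp
    ring
  change IntegrableOn g _ ∧ ∫ y in Set.Ioi (0 : ℝ), g y = _
  rw [← himg, integrableOn_image_iff_integrableOn_abs_deriv_smul MeasurableSet.univ hderiv hinj,
    integral_image_eq_integral_abs_deriv_smul MeasurableSet.univ hderiv hinj]
  simp_rw [hpull, integrableOn_univ, Measure.restrict_univ]
  refine ⟨(integrable_inv_sq_add_pi_sq_mul L).const_mul _, ?_⟩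
  rw [integral_const_mul, integral_inv_sq_add_pi_sq_mul L hLpos.ne', hexpL, hcL]
  have h1 : z - w ≠ 0 := by linarith
  have h2 : 1 - z / w = -(z - w) / w := by
    field_simp
    ring
  rw [h2]
  field_simp
  ring

/-- The pdf of the geometric gamma innovation distribution, obtained by the complex
inversion formula, has Laplace transform `1/(1 + αθ log((s+β)/β))`. -/
theorem geometric_gamma_innovation_pdf
    (α β θ s₀ : ℝ) (hα : 0 < α) (hβ : 0 < β) (hθ : θ ∈ Set.Ioo (0 : ℝ) 1)
    (hs₀ : s₀ = β * (Real.exp (-1 / (α * θ)) - 1))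
    (f : ℝ → ℝ)
    (hf : ∀ x > (0 : ℝ), f x =
      (s₀ + β) / (α * θ) * Real.exp (s₀ * x) +
        Real.exp (-β * x) * ∫ y in Set.Ioi (0 : ℝ),
          α * θ * Real.exp (-x * y) /
            ((1 + α * θ * Real.log (y / β)) ^ 2 + Real.pi ^ 2 * α ^ 2 * θ ^ 2)) :
    s₀ ∈ Set.Ioo (-β) 0 ∧ 1 + α * θ * Real.log ((s₀ + β) / β) = 0 ∧
    ∀ s > 0, ∫ x in Set.Ioi (0 : ℝ), Real.exp (-s * x) * f x
      = 1 / (1 + α * θ * Real.log ((s + β) / β)) := by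
  have hc : 0 < α * θ := mul_pos hα hθ.1
  have hw : s₀ + β = β * Real.exp (-1 / (α * θ)) := by rw [hs₀]; ring
  have hE : Real.exp (-1 / (α * θ)) < 1 :=
    Real.exp_lt_one_iff.2 (div_neg_of_neg_of_pos (by norm_num) hc)
  have hs₀neg : s₀ < 0 := by
    rw [hs₀]
    exact mul_neg_of_pos_of_neg hβ (by linarith)
  refine ⟨⟨?_, hs₀neg⟩, ?_, ?_⟩
  · have : 0 < s₀ + β := by rw [hw]; positivity
    linarith
  · rw [hw, mul_div_cancel_left₀ _ hβ.ne', Real.log_exp, mul_div_cancel₀ _ hc.ne']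
    norm_num
  intro s hs
  set k : ℝ → ℝ :=
    fun y => α * θ / ((1 + α * θ * Real.log (y / β)) ^ 2 + π ^ 2 * (α * θ) ^ 2) with hk
  obtain ⟨hki, hkint⟩ := integral_log_kernel_div_add (α * θ) β (s + β) hc hβ (by linarith)
  obtain ⟨hli, hlint⟩ := integral_exp_mul_laplace_eq_stieltjes k (by rw [hk]; fun_prop) (s + β)
    (by linarith) hki
  have hsum : ∀ x ∈ Set.Ioi (0 : ℝ), Real.exp (-s * x) * f x
      = (s₀ + β) / (α * θ) * Real.exp ((s₀ - s) * x)
        + Real.exp (-(s + β) * x) * ∫ y in Set.Ioi (0 : ℝ), k y * Real.exp (-x * y) := by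
    intro x hx
    have hinner : ∫ y in Set.Ioi (0 : ℝ), α * θ * Real.exp (-x * y) /
        ((1 + α * θ * Real.log (y / β)) ^ 2 + Real.pi ^ 2 * α ^ 2 * θ ^ 2)
        = ∫ y in Set.Ioi (0 : ℝ), k y * Real.exp (-x * y) := by
      congr 1 with y
      rw [hk]
      ring_nf
    rw [hf x hx, hinner, mul_add, mul_left_comm, ← Real.exp_add, ← mul_assoc (Real.exp (-s * x)),
      ← Real.exp_add]
    ring_nf
  rw [setIntegral_congr_fun measurableSet_Ioi hsum,
    integral_add ((integrableOn_exp_mul_Ioi (by linarith) 0).const_mul _) hli, hlint, hkint,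
    integral_const_mul, integral_exp_mul_Ioi (by linarith), ← hw, mul_zero, Real.exp_zero,
    show s + β - (s₀ + β) = -(s₀ - s) by ring, div_neg]
  ring
end

section
/- Let δ > 0, γ > 0 and θ ∈ (0,1) with θδγ > 1, and set s₀ = (γ²/2)(1 − 1/(θδγ))² − γ²/2, so that s₀ ∈ (−γ²/2, 0) and 1 + θδ(√(2s₀ + γ²) − γ) = 0. Define f : (0,∞) → ℝ by f(x) = (√(2s₀ + γ²)/(θδ)) e^{s₀ x} + (1/π) e^{−γ²x/2} ∫_0^∞ e^{−xu} θδ √(2u) / [ (1 − θδγ)² + 2 θ² δ² u ] du. Then for every s > 0, ∫_0^∞ e^{−sx} f(x) dx = 1/(1 + θδ(√(2s + γ²) − γ)). -/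
open Real MeasureTheory

/-- The Stieltjes-type integral `∫₀^∞ √(2u) / ((p² + 2u)(q² + 2u)) du = π / (2(p + q))`. -/
lemma integral_sqrt_div_mul {p q : ℝ} (hp : 0 < p) (hpq : p < q) :
    IntegrableOn (fun u : ℝ => √(2 * u) / ((p ^ 2 + 2 * u) * (q ^ 2 + 2 * u))) (Set.Ioi 0) ∧
    ∫ u in Set.Ioi (0 : ℝ), √(2 * u) / ((p ^ 2 + 2 * u) * (q ^ 2 + 2 * u))
      = π / (2 * (p + q)) := by
  have hq : 0 < q := hp.trans hpq
  have hd : q ^ 2 - p ^ 2 ≠ 0 := by nlinarith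
  let G : ℝ → ℝ := fun u =>
    (q * arctan (√(2 * u) / q) - p * arctan (√(2 * u) / p)) / (q ^ 2 - p ^ 2)
  have hG : Continuous G := by
    have := continuous_arctan
    fun_prop
  have hderiv : ∀ u ∈ Set.Ioi (0 : ℝ),
      HasDerivAt G (√(2 * u) / ((p ^ 2 + 2 * u) * (q ^ 2 + 2 * u))) u := by
    intro u hu
    have hu : 0 < u := hu
    have h2u : 0 < 2 * u := by positivity
    have hr : HasDerivAt (fun u : ℝ => √(2 * u)) (1 / √(2 * u)) u := by
      have h := ((hasDerivAt_id u).const_mul 2).sqrt h2u.ne'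
      exact h.congr_deriv (by simp only [id]; field_simp)
    have hterm : ∀ b : ℝ, 0 < b → HasDerivAt (fun u : ℝ => b * arctan (√(2 * u) / b))
        (b ^ 2 / ((b ^ 2 + 2 * u) * √(2 * u))) u := by
      intro b hb
      refine (((hr.div_const b).arctan).const_mul b).congr_deriv ?_
      have hs : 0 < √(2 * u) := sqrt_pos.2 h2u
      rw [div_pow, sq_sqrt h2u.le]
      field_simp
    refine (((hterm q hq).sub (hterm p hp)).div_const (q ^ 2 - p ^ 2)).congr_deriv ?_
    have hs : 0 < √(2 * u) := sqrt_pos.2 h2u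
    have hsq : √(2 * u) ^ 2 = 2 * u := sq_sqrt h2u.le
    field_simp
    rw [hsq]
    ring
  have hnonneg : ∀ u ∈ Set.Ioi (0 : ℝ),
      0 ≤ √(2 * u) / ((p ^ 2 + 2 * u) * (q ^ 2 + 2 * u)) := by
    intro u hu
    have hu : 0 < u := hu
    positivity
  have hlim : Filter.Tendsto G Filter.atTop
      (nhds ((q * (π / 2) - p * (π / 2)) / (q ^ 2 - p ^ 2))) := by
    have hr : Filter.Tendsto (fun u : ℝ => √(2 * u)) Filter.atTop Filter.atTop :=
      tendsto_sqrt_atTop.comp (Filter.tendsto_id.const_mul_atTop two_pos)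
    have hterm : ∀ b : ℝ, 0 < b → Filter.Tendsto (fun u : ℝ => b * arctan (√(2 * u) / b))
        Filter.atTop (nhds (b * (π / 2))) := fun b hb =>
      ((tendsto_arctan_atTop.mono_right nhdsWithin_le_nhds).comp
        (hr.atTop_div_const hb)).const_mul b
    exact ((hterm q hq).sub (hterm p hp)).div_const _
  refine ⟨integrableOn_Ioi_deriv_of_nonneg hG.continuousWithinAt hderiv hnonneg hlim, ?_⟩
  rw [integral_Ioi_of_hasDerivAt_of_nonneg hG.continuousWithinAt hderiv hnonneg hlim]
  have h0 : G 0 = 0 := by simp [G]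
  rw [h0, sub_zero]
  have : q ^ 2 - p ^ 2 = (q - p) * (p + q) := by ring
  have h1 : q - p ≠ 0 := (sub_pos.2 hpq).ne'
  have h2 : p + q ≠ 0 := by positivity
  rw [this]
  field_simp

lemma integral_exp_neg_mul_Ioi {a : ℝ} (ha : 0 < a) :
    ∫ x in Set.Ioi (0 : ℝ), exp (-a * x) = 1 / a := by
  rw [integral_exp_mul_Ioi (neg_lt_zero.2 ha)]
  simp

/-- The iterated Laplace transform of a nonnegative function is its Stieltjes transform. -/
lemma integral_exp_mul_laplace {k : ℝ → ℝ} {σ : ℝ} (hσ : 0 < σ) (hk : Measurable k)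
    (hk0 : ∀ u > 0, 0 ≤ k u)
    (hint : IntegrableOn (fun u => k u / (σ + u)) (Set.Ioi 0)) :
    IntegrableOn (fun x => exp (-σ * x) * ∫ u in Set.Ioi (0 : ℝ), exp (-x * u) * k u)
      (Set.Ioi 0) ∧
    ∫ x in Set.Ioi (0 : ℝ), exp (-σ * x) * ∫ u in Set.Ioi (0 : ℝ), exp (-x * u) * k u
      = ∫ u in Set.Ioi (0 : ℝ), k u / (σ + u) := by
  let F : ℝ → ℝ → ℝ := fun x u => exp (-(σ + u) * x) * k u
  have hF : ∀ x, exp (-σ * x) * ∫ u in Set.Ioi (0 : ℝ), exp (-x * u) * k u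
      = ∫ u in Set.Ioi (0 : ℝ), F x u := by
    intro x
    rw [← integral_const_mul]
    refine integral_congr_ae (.of_forall fun u => ?_)
    simp only [F]
    rw [← mul_assoc, ← exp_add]
    ring_nf
  have hinner : ∀ u > 0, ∫ x in Set.Ioi (0 : ℝ), F x u = k u / (σ + u) := by
    intro u hu
    simp only [F]
    rw [integral_mul_const, integral_exp_neg_mul_Ioi (by positivity)]
    ring
  have hprod : Integrable (Function.uncurry F)
      ((volume.restrict (Set.Ioi 0)).prod (volume.restrict (Set.Ioi 0))) := by
    have hmeas : Measurable (Function.uncurry F) := by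
      simp only [F, Function.uncurry_def]
      fun_prop
    rw [integrable_prod_iff' hmeas.aestronglyMeasurable]
    constructor
    · filter_upwards [ae_restrict_mem measurableSet_Ioi] with u hu
      have hu : 0 < u := hu
      exact (integrableOn_exp_mul_Ioi (neg_lt_zero.2 (add_pos hσ hu)) 0).mul_const (k u)
    · refine hint.congr ?_
      filter_upwards [ae_restrict_mem measurableSet_Ioi] with u hu
      rw [← hinner u hu]
      refine integral_congr_ae (.of_forall fun x => ?_)
      exact (norm_of_nonneg (mul_nonneg (exp_pos _).le (hk0 u hu))).symm
  simp only [hF]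
  refine ⟨hprod.integral_prod_left, ?_⟩
  rw [integral_integral_swap hprod]
  exact setIntegral_congr_fun measurableSet_Ioi hinner

/-- The pdf of the geometric inverse Gaussian innovation distribution, obtained by the
complex inversion formula, has Laplace transform `1/(1 + θδ(√(2s+γ²) − γ))`. -/
theorem geometric_inverse_gaussian_innovation_pdf
    (δ γ θ s₀ : ℝ) (hδ : 0 < δ) (hγ : 0 < γ) (hθ : θ ∈ Set.Ioo (0 : ℝ) 1)
    (hpole : 1 < θ * δ * γ)
    (hs₀ : s₀ = γ ^ 2 / 2 * (1 - 1 / (θ * δ * γ)) ^ 2 - γ ^ 2 / 2)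
    (f : ℝ → ℝ)
    (hf : ∀ x > (0 : ℝ), f x =
      Real.sqrt (2 * s₀ + γ ^ 2) / (θ * δ) * Real.exp (s₀ * x) +
        (1 / Real.pi) * Real.exp (-γ ^ 2 * x / 2) * ∫ u in Set.Ioi (0 : ℝ),
          Real.exp (-x * u) * (θ * δ * Real.sqrt (2 * u)) /
            ((1 - θ * δ * γ) ^ 2 + 2 * θ ^ 2 * δ ^ 2 * u)) :
    s₀ ∈ Set.Ioo (-(γ ^ 2) / 2) 0 ∧ 1 + θ * δ * (Real.sqrt (2 * s₀ + γ ^ 2) - γ) = 0 ∧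
    ∀ s > 0, ∫ x in Set.Ioi (0 : ℝ), Real.exp (-s * x) * f x
      = 1 / (1 + θ * δ * (Real.sqrt (2 * s + γ ^ 2) - γ)) := by
  obtain ⟨hθ0, -⟩ := hθ
  set c := θ * δ with hc
  have hc0 : 0 < c := mul_pos hθ0 hδ
  have hcγ : 0 < c * γ := by positivity
  obtain ⟨p, hp⟩ : ∃ p, p = γ - 1 / c := ⟨_, rfl⟩
  have hcp : c * p = c * γ - 1 := by rw [hp]; field_simp
  have hp0 : 0 < p := by
    by_contra! h
    nlinarith
  have hpγ : p < γ := by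
    have : 0 < 1 / c := by positivity
    linarith
  have hs₀p : 2 * s₀ + γ ^ 2 = p ^ 2 := by
    rw [hs₀, hp]
    field_simp
    ring
  have hroot : √(2 * s₀ + γ ^ 2) = p := by rw [hs₀p, sqrt_sq hp0.le]
  refine ⟨⟨by nlinarith, by nlinarith⟩, by rw [hroot]; linarith, ?_⟩
  intro s hs
  obtain ⟨q, hq⟩ : ∃ q, q = √(2 * s + γ ^ 2) := ⟨_, rfl⟩
  have hq2 : q ^ 2 = 2 * s + γ ^ 2 := by rw [hq, sq_sqrt (by positivity)]
  have hγq : γ < q := by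
    rw [hq]
    exact lt_sqrt_of_sq_lt (by linarith)
  have hpq : p < q := hpγ.trans hγq
  have hq0 : 0 < q := hp0.trans hpq
  let k : ℝ → ℝ := fun u => c * √(2 * u) / ((1 - c * γ) ^ 2 + 2 * θ ^ 2 * δ ^ 2 * u)
  have hden : ∀ u, (1 - c * γ) ^ 2 + 2 * θ ^ 2 * δ ^ 2 * u = c ^ 2 * (p ^ 2 + 2 * u) := by
    intro u
    have : 1 - c * γ = -(c * p) := by linarith
    rw [this, hc]
    ring
  have hkdiv : ∀ u ∈ Set.Ioi (0 : ℝ), k u / (q ^ 2 / 2 + u)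
      = 2 / c * (√(2 * u) / ((p ^ 2 + 2 * u) * (q ^ 2 + 2 * u))) := by
    intro u hu
    have hu : 0 < u := hu
    simp only [k, hden]
    field_simp
  obtain ⟨hint, hval⟩ := integral_sqrt_div_mul hp0 hpq
  obtain ⟨hLint, hLval⟩ := integral_exp_mul_laplace (k := k) (σ := q ^ 2 / 2) (by positivity)
    (by simp only [k]; fun_prop)
    (fun u hu => by simp only [k, hden]; positivity)
    ((integrableOn_congr_fun hkdiv measurableSet_Ioi).2 (hint.const_mul _))
  rw [setIntegral_congr_fun measurableSet_Ioi hkdiv, integral_const_mul, hval] at hLval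
  have hss₀ : 0 < s - s₀ := by nlinarith
  have hfx : ∀ x ∈ Set.Ioi (0 : ℝ), exp (-s * x) * f x
      = p / c * exp (-(s - s₀) * x) + 1 / π *
        (exp (-(q ^ 2 / 2) * x) * ∫ u in Set.Ioi (0 : ℝ), exp (-x * u) * k u) := by
    intro x hx
    have e1 : exp (-(s - s₀) * x) = exp (-s * x) * exp (s₀ * x) := by
      rw [← exp_add]; ring_nf
    have e2 : exp (-(q ^ 2 / 2) * x) = exp (-s * x) * exp (-γ ^ 2 * x / 2) := by
      rw [← exp_add, hq2]; ring_nf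
    rw [hf x hx, hroot, e1, e2]
    simp only [k, mul_div_assoc]
    ring
  rw [setIntegral_congr_fun measurableSet_Ioi hfx,
    integral_add ((integrableOn_exp_mul_Ioi (neg_lt_zero.2 hss₀) 0).const_mul _)
      (hLint.const_mul _),
    integral_const_mul, integral_const_mul, integral_exp_neg_mul_Ioi hss₀, hLval, ← hq]
  have h1 : s - s₀ = (q - p) * (q + p) / 2 := by nlinarith
  have h2 : 1 + c * (q - γ) = c * (q - p) := by linarith
  have h3 : q - p ≠ 0 := (sub_pos.2 hpq).ne'
  have h4 : q + p ≠ 0 := by positivity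
  rw [h1, h2, add_comm p q]
  field_simp
  ring
end

section
/- Let θ > 0, λ > 0 and β ∈ (0,1), and let ε be a nonnegative random variable with E[exp(-sε)] = 1/(1 + θ((s+λ)^β − λ^β)) for all s ≥ 0. Then ε has finite first and second moments given by E[ε] = θ β λ^{β−1} and E[ε²] = θ β (1−β) λ^{β−2} + 2 θ² β² λ^{2β−2}. -/
open MeasureTheory

open ProbabilityTheory Filter Topology

/-- If `E[X ^ n * exp (t * X)]` converges as `t` increases to `0`, then `X ^ n` is integrable and
its integral is the limit. -/
theorem integrable_pow_and_integral_eq_of_tendsto_nhdsLT_zero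
    {Ω : Type*} [MeasurableSpace Ω] {μ : Measure Ω} {X : Ω → ℝ} (hX : Measurable X)
    (hX_nonneg : ∀ᵐ ω ∂μ, 0 ≤ X ω) {n : ℕ} {L : ℝ}
    (hint : ∀ t < 0, Integrable (fun ω => X ω ^ n * Real.exp (t * X ω)) μ)
    (hL : Tendsto (fun t => ∫ ω, X ω ^ n * Real.exp (t * X ω) ∂μ) (𝓝[<] 0) (𝓝 L)) :
    Integrable (fun ω => X ω ^ n) μ ∧ ∫ ω, X ω ^ n ∂μ = L := by
  have hnn (t : ℝ) : 0 ≤ᵐ[μ] fun ω => X ω ^ n * Real.exp (t * X ω) := by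
    filter_upwards [hX_nonneg] with ω hω
    positivity
  have hpow_nn : 0 ≤ᵐ[μ] fun ω => X ω ^ n := by
    filter_upwards [hX_nonneg] with ω hω
    positivity
  obtain ⟨u, hu_mono, hu_neg, hu_lim⟩ := exists_seq_strictMono_tendsto (0 : ℝ)
  have hu : Tendsto u atTop (𝓝[<] 0) :=
    tendsto_nhdsWithin_iff.2 ⟨hu_lim, Eventually.of_forall hu_neg⟩
  have hlim := hL.comp hu
  have hL_nonneg : 0 ≤ L :=
    ge_of_tendsto hlim (Eventually.of_forall fun k => integral_nonneg_of_ae (hnn (u k)))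
  have hlint : Tendsto (fun k => ∫⁻ ω, ENNReal.ofReal (X ω ^ n * Real.exp (u k * X ω)) ∂μ) atTop
      (𝓝 (∫⁻ ω, ENNReal.ofReal (X ω ^ n) ∂μ)) := by
    refine lintegral_tendsto_of_tendsto_of_monotone (fun k => by fun_prop) ?_ ?_
    · filter_upwards [hX_nonneg] with ω hω
      intro i j hij
      have := hu_mono.monotone hij
      dsimp only
      gcongr
    · refine Eventually.of_forall fun ω => ENNReal.tendsto_ofReal ?_
      have h : Tendsto (fun t : ℝ => X ω ^ n * Real.exp (t * X ω)) (𝓝 0)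
          (𝓝 (X ω ^ n * Real.exp (0 * X ω))) :=
        Continuous.tendsto (by fun_prop) 0
      simpa [Function.comp_def] using h.comp hu_lim
  have hlintegral : ∫⁻ ω, ENNReal.ofReal (X ω ^ n) ∂μ = ENNReal.ofReal L := by
    refine tendsto_nhds_unique hlint ((ENNReal.tendsto_ofReal hlim).congr fun k => ?_)
    exact ofReal_integral_eq_lintegral_ofReal (hint _ (hu_neg k)) (hnn _)
  have hmeas : AEStronglyMeasurable (fun ω => X ω ^ n) μ := by fun_prop
  refine ⟨⟨hmeas, ?_⟩, ?_⟩
  · rw [hasFiniteIntegral_iff_ofReal hpow_nn, hlintegral]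
    exact ENNReal.ofReal_lt_top
  · rw [integral_eq_lintegral_of_nonneg_ae hpow_nn hmeas, hlintegral,
      ENNReal.toReal_ofReal hL_nonneg]

/-- For a random variable that is almost surely nonnegative, every negative real lies in the
interior of the set where the moment generating function is finite. -/
theorem mem_interior_integrableExpSet_of_nonneg
    {Ω : Type*} [MeasurableSpace Ω] {μ : Measure Ω} [IsFiniteMeasure μ] {X : Ω → ℝ}
    (hX : Measurable X) (hX_nonneg : ∀ᵐ ω ∂μ, 0 ≤ X ω) {t : ℝ} (ht : t < 0) :
    t ∈ interior (integrableExpSet X μ) := by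
  refine mem_interior.2 ⟨Set.Iio 0, fun u hu => ?_, isOpen_Iio, ht⟩
  refine Integrable.of_bound (C := 1) (by fun_prop) ?_
  filter_upwards [hX_nonneg] with ω hω
  rw [Real.norm_eq_abs, Real.abs_exp, Real.exp_le_one_iff]
  exact mul_nonpos_of_nonpos_of_nonneg (le_of_lt hu) hω

/-- First and second moments of the geometric tempered stable innovation distribution. -/
theorem geometric_tempered_stable_moments
    {Ω : Type*} [MeasurableSpace Ω] (μ : Measure Ω) [IsProbabilityMeasure μ]
    (ε : Ω → ℝ) (hεm : Measurable ε) (hεnn : ∀ᵐ ω ∂μ, 0 ≤ ε ω)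
    (θ lam β : ℝ) (hθ : 0 < θ) (hlam : 0 < lam) (hβ : β ∈ Set.Ioo (0 : ℝ) 1)
    (hLap : ∀ s ≥ 0, ∫ ω, Real.exp (-s * ε ω) ∂μ
      = 1 / (1 + θ * ((s + lam) ^ β - lam ^ β))) :
    Integrable ε μ ∧ Integrable (fun ω => ε ω ^ 2) μ ∧
    ∫ ω, ε ω ∂μ = θ * β * lam ^ (β - 1) ∧
    ∫ ω, ε ω ^ 2 ∂μ = θ * β * (1 - β) * lam ^ (β - 2) + 2 * θ ^ 2 * β ^ 2 * lam ^ (2 * β - 2) := by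
  have hmem {t : ℝ} (ht : t < 0) : t ∈ interior (integrableExpSet ε μ) :=
    mem_interior_integrableExpSet_of_nonneg hεm hεnn ht
  have hint (n : ℕ) (t : ℝ) (ht : t < 0) :
      Integrable (fun ω => ε ω ^ n * Real.exp (t * ε ω)) μ :=
    integrable_pow_mul_exp_of_mem_interior_integrableExpSet (hmem ht) n
  let D : ℝ → ℝ := fun t => 1 + θ * ((lam - t) ^ β - lam ^ β)
  have hD_pos {t : ℝ} (ht : t < 0) : 0 < D t := by
    have : lam ^ β ≤ (lam - t) ^ β :=
      Real.rpow_le_rpow hlam.le (by linarith) hβ.1.le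
    have := mul_nonneg hθ.le (sub_nonneg.2 this)
    simp only [D]
    linarith
  have hrpow (p : ℝ) {t : ℝ} (ht : t < lam) :
      HasDerivAt (fun t => (lam - t) ^ p) (-p * (lam - t) ^ (p - 1)) t := by
    exact (((hasDerivAt_id' t).const_sub lam).rpow_const (p := p)
      (Or.inl (sub_pos.2 ht).ne')).congr_deriv (by ring)
  have hD {t : ℝ} (ht : t < lam) :
      HasDerivAt D (-(θ * β * (lam - t) ^ (β - 1))) t := by
    exact ((((hrpow β ht).sub_const (lam ^ β)).const_mul θ).const_add 1).congr_deriv (by ring)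
  have hmgf {t : ℝ} (ht : t < 0) :
      ∫ ω, ε ω ^ 0 * Real.exp (t * ε ω) ∂μ = (D t)⁻¹ := by
    have := hLap (-t) (by linarith)
    simp only [neg_neg] at this
    simp only [pow_zero, one_mul, this, D, one_div]
    rw [neg_add_eq_sub]
  have hfirst {t : ℝ} (ht : t < 0) : ∫ ω, ε ω ^ 1 * Real.exp (t * ε ω) ∂μ =
      θ * β * (lam - t) ^ (β - 1) / D t ^ 2 := by
    have h := hasDerivAt_integral_pow_mul_exp_real (hmem ht) 0
    refine h.unique ((((hD (ht.trans hlam)).inv (hD_pos ht).ne').congr_of_eventuallyEq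
      ?_).congr_deriv (by ring))
    filter_upwards [Iio_mem_nhds ht] with u hu using hmgf hu
  have hsecond {t : ℝ} (ht : t < 0) : ∫ ω, ε ω ^ 2 * Real.exp (t * ε ω) ∂μ =
      θ * β * (1 - β) * (lam - t) ^ (β - 2) / D t ^ 2 +
        2 * θ ^ 2 * β ^ 2 * ((lam - t) ^ (β - 1)) ^ 2 / D t ^ 3 := by
    have h := hasDerivAt_integral_pow_mul_exp_real (hmem ht) 1
    have hne := (hD_pos ht).ne'
    refine h.unique (((((hrpow (β - 1) (ht.trans hlam)).const_mul (θ * β)).div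
      ((hD (ht.trans hlam)).pow 2) (pow_ne_zero 2 hne)).congr_of_eventuallyEq
      ?_).congr_deriv ?_)
    · filter_upwards [Iio_mem_nhds ht] with u hu using hfirst hu
    · rw [show β - 1 - 1 = β - 2 by ring]
      simp only [Pi.pow_apply]
      field_simp
      ring
  have hD_cont : ContinuousAt D 0 := (hD hlam).continuousAt
  have hD_zero : D 0 = 1 := by simp [D]
  have hrpow_cont (p : ℝ) : ContinuousAt (fun t => (lam - t) ^ p) 0 := (hrpow p hlam).continuousAt
  have hlim_first : Tendsto (fun t => ∫ ω, ε ω ^ 1 * Real.exp (t * ε ω) ∂μ) (𝓝[<] 0)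
      (𝓝 (θ * β * lam ^ (β - 1))) := by
    have h : ContinuousAt (fun t => θ * β * (lam - t) ^ (β - 1) / D t ^ 2) 0 :=
      (continuousAt_const.mul (hrpow_cont _)).div (hD_cont.pow 2) (by simp [hD_zero])
    have h' := h.tendsto.mono_left (nhdsWithin_le_nhds (s := Set.Iio 0))
    simp only [hD_zero, sub_zero, one_pow, div_one] at h'
    refine h'.congr' ?_
    filter_upwards [self_mem_nhdsWithin] with t ht using (hfirst ht).symm
  have hlim_second : Tendsto (fun t => ∫ ω, ε ω ^ 2 * Real.exp (t * ε ω) ∂μ) (𝓝[<] 0)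
      (𝓝 (θ * β * (1 - β) * lam ^ (β - 2) + 2 * θ ^ 2 * β ^ 2 * lam ^ (2 * β - 2))) := by
    have h : ContinuousAt (fun t => θ * β * (1 - β) * (lam - t) ^ (β - 2) / D t ^ 2 +
        2 * θ ^ 2 * β ^ 2 * ((lam - t) ^ (β - 1)) ^ 2 / D t ^ 3) 0 :=
      ((continuousAt_const.mul (hrpow_cont _)).div (hD_cont.pow 2) (by simp [hD_zero])).add
        ((continuousAt_const.mul ((hrpow_cont _).pow 2)).div (hD_cont.pow 3) (by simp [hD_zero]))
    have h' := h.tendsto.mono_left (nhdsWithin_le_nhds (s := Set.Iio 0))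
    have hsq : (lam ^ (β - 1)) ^ 2 = lam ^ (2 * β - 2) := by
      rw [← Real.rpow_mul_natCast hlam.le]
      congr 1
      push_cast
      ring
    simp only [hD_zero, sub_zero, one_pow, div_one, hsq] at h'
    refine h'.congr' ?_
    filter_upwards [self_mem_nhdsWithin] with t ht using (hsecond ht).symm
  obtain ⟨hi₁, he₁⟩ := integrable_pow_and_integral_eq_of_tendsto_nhdsLT_zero hεm hεnn
    (hint 1) hlim_first
  obtain ⟨hi₂, he₂⟩ := integrable_pow_and_integral_eq_of_tendsto_nhdsLT_zero hεm hεnn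
    (hint 2) hlim_second
  simp only [pow_one] at hi₁ he₁
  exact ⟨hi₁, hi₂, he₁, he₂⟩
end

section
/- Let θ > 0, α > 0 and β > 0, and let ε be a nonnegative random variable with E[exp(-sε)] = 1/(1 + αθ log((s+β)/β)) for all s ≥ 0. Then ε has finite first and second moments given by E[ε] = θα/β and E[ε²] = (θα + 2θ²α²)/β². -/
open MeasureTheory ProbabilityTheory Filter Topology

/-- If `X ^ n * exp (t * X)` is integrable for `t < 0` and its integral has a limit as `t → 0⁻`,
then `X ^ n` is integrable and its integral is that limit. -/
lemma integrable_pow_and_integral_eq_of_tendsto_exp_mul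
    {Ω : Type*} [MeasurableSpace Ω] {μ : Measure Ω} {X : Ω → ℝ} (hXm : Measurable X)
    (hX : ∀ᵐ ω ∂μ, 0 ≤ X ω) (n : ℕ) {L : ℝ}
    (hint : ∀ t < 0, Integrable (fun ω => X ω ^ n * Real.exp (t * X ω)) μ)
    (hL : Tendsto (fun t => ∫ ω, X ω ^ n * Real.exp (t * X ω) ∂μ) (𝓝[<] 0) (𝓝 L)) :
    Integrable (fun ω => X ω ^ n) μ ∧ ∫ ω, X ω ^ n ∂μ = L := by
  obtain ⟨u, hu_mono, hu_neg, hu_tendsto⟩ := exists_seq_strictMono_tendsto (0 : ℝ)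
  have hu : Tendsto u atTop (𝓝[<] 0) :=
    tendsto_nhdsWithin_iff.2 ⟨hu_tendsto, .of_forall hu_neg⟩
  have hlim := hL.comp hu
  have hpow : 0 ≤ᵐ[μ] fun ω => X ω ^ n := by
    filter_upwards [hX] with ω hω using pow_nonneg hω n
  have hmono : ∀ᵐ ω ∂μ, Monotone fun k => X ω ^ n * Real.exp (u k * X ω) := by
    filter_upwards [hX] with ω hω i j hij
    have := hu_mono.monotone hij
    dsimp only
    gcongr
  have hptw : ∀ᵐ ω ∂μ, Tendsto (fun k => X ω ^ n * Real.exp (u k * X ω)) atTop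
      (𝓝 (X ω ^ n)) := by
    refine .of_forall fun ω => ?_
    simpa using ((hu_tendsto.mul_const (X ω)).rexp).const_mul (X ω ^ n)
  have hlintegral : Tendsto (fun k => ∫⁻ ω, ENNReal.ofReal (X ω ^ n * Real.exp (u k * X ω)) ∂μ)
      atTop (𝓝 (∫⁻ ω, ENNReal.ofReal (X ω ^ n) ∂μ)) := by
    refine lintegral_tendsto_of_tendsto_of_monotone
      (fun k => (hint _ (hu_neg k)).aemeasurable.ennreal_ofReal) ?_ ?_
    · filter_upwards [hmono] with ω hω i j hij using ENNReal.ofReal_le_ofReal (hω hij)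
    · filter_upwards [hptw] with ω hω using ENNReal.tendsto_ofReal hω
  have heq : ∫⁻ ω, ENNReal.ofReal (X ω ^ n) ∂μ = ENNReal.ofReal L := by
    refine tendsto_nhds_unique hlintegral ((ENNReal.tendsto_ofReal hlim).congr fun k => ?_)
    refine ofReal_integral_eq_lintegral_ofReal (hint _ (hu_neg k)) ?_
    filter_upwards [hpow] with ω hω using mul_nonneg hω (Real.exp_nonneg _)
  have hpow_int : Integrable (fun ω => X ω ^ n) μ := by
    refine (lintegral_ofReal_ne_top_iff_integrable (hXm.pow_const n).aestronglyMeasurable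
      hpow).1 ?_
    simp [heq]
  exact ⟨hpow_int, tendsto_nhds_unique
    (integral_tendsto_of_tendsto_of_monotone (fun k => hint _ (hu_neg k)) hpow_int hmono hptw)
    hlim⟩

/-- First and second moments of the geometric gamma innovation distribution. -/
theorem geometric_gamma_moments
    {Ω : Type*} [MeasurableSpace Ω] (μ : Measure Ω) [IsProbabilityMeasure μ]
    (ε : Ω → ℝ) (hεm : Measurable ε) (hεnn : ∀ᵐ ω ∂μ, 0 ≤ ε ω)
    (θ α β : ℝ) (hθ : 0 < θ) (hα : 0 < α) (hβ : 0 < β)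
    (hLap : ∀ s ≥ 0, ∫ ω, Real.exp (-s * ε ω) ∂μ
      = 1 / (1 + α * θ * Real.log ((s + β) / β))) :
    Integrable ε μ ∧ Integrable (fun ω => ε ω ^ 2) μ ∧
    ∫ ω, ε ω ∂μ = θ * α / β ∧
    ∫ ω, ε ω ^ 2 ∂μ = (θ * α + 2 * θ ^ 2 * α ^ 2) / β ^ 2 := by
  have hexp : Set.Iio 0 ⊆ integrableExpSet ε μ := by
    intro t ht
    refine Integrable.of_bound (C := 1) (by fun_prop) ?_
    filter_upwards [hεnn] with ω hω
    rw [Real.norm_eq_abs, Real.abs_exp, Real.exp_le_one_iff]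
    exact mul_nonpos_of_nonpos_of_nonneg (le_of_lt ht) hω
  have hmem : ∀ t < 0, t ∈ interior (integrableExpSet ε μ) := fun t ht =>
    interior_maximal hexp isOpen_Iio ht
  have hint : ∀ n : ℕ, ∀ t < 0, Integrable (fun ω => ε ω ^ n * Real.exp (t * ε ω)) μ :=
    fun n t ht => integrable_pow_mul_exp_of_mem_interior_integrableExpSet (hmem t ht) n
  set D : ℝ → ℝ := fun t => 1 + α * θ * Real.log ((β - t) / β) with hD
  have hD_pos : ∀ t ≤ 0, 0 < D t := by
    intro t ht
    have : 0 ≤ Real.log ((β - t) / β) :=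
      Real.log_nonneg ((one_le_div hβ).2 (by linarith))
    positivity
  have hD_deriv : ∀ t ≤ 0, HasDerivAt D (-(α * θ) / (β - t)) t := by
    intro t ht
    have hβt : β - t ≠ 0 := by linarith
    have h := ((((hasDerivAt_id t).const_sub β).div_const β).log
      (div_ne_zero hβt hβ.ne')).const_mul (α * θ) |>.const_add 1
    refine h.congr_deriv ?_
    simp only [id]
    field_simp
  have h_zero : ∀ t < 0, ∫ ω, ε ω ^ 0 * Real.exp (t * ε ω) ∂μ = (D t)⁻¹ := by
    intro t ht
    have h := hLap (-t) (by linarith)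
    simp only [neg_neg] at h
    simp [h, hD, neg_add_eq_sub]
  have h_one : ∀ t < 0, ∫ ω, ε ω ^ 1 * Real.exp (t * ε ω) ∂μ
      = α * θ / ((β - t) * D t ^ 2) := by
    intro t ht
    have hβt : β - t ≠ 0 := by linarith
    have hDt := (hD_pos t ht.le).ne'
    have h := hasDerivAt_integral_pow_mul_exp_real (hmem t ht) 0
    refine (h.congr_of_eventuallyEq ?_).unique ((hD_deriv t ht.le).inv hDt) |>.trans ?_
    · filter_upwards [Iio_mem_nhds ht] with x hx using (h_zero x hx).symm
    · field_simp
  have h_two : ∀ t < 0, ∫ ω, ε ω ^ 2 * Real.exp (t * ε ω) ∂μ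
      = α * θ * (D t + 2 * (α * θ)) / ((β - t) ^ 2 * D t ^ 3) := by
    intro t ht
    have hβt : β - t ≠ 0 := by linarith
    have hDt := (hD_pos t ht.le).ne'
    have h := hasDerivAt_integral_pow_mul_exp_real (hmem t ht) 1
    have hden := (((hasDerivAt_id t).const_sub β).mul ((hD_deriv t ht.le).pow 2)).inv
      (mul_ne_zero hβt (pow_ne_zero 2 hDt)) |>.const_mul (α * θ)
    refine (h.congr_of_eventuallyEq ?_).unique hden |>.trans ?_
    · filter_upwards [Iio_mem_nhds ht] with x hx
      rw [h_one x hx]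
      simp [div_eq_mul_inv]
    · simp
      field_simp
      ring
  have hD_zero : D 0 = 1 := by simp [hD, hβ.ne']
  have hD_cont : ContinuousAt D 0 := (hD_deriv 0 le_rfl).continuousAt
  have hL1 : Tendsto (fun t => ∫ ω, ε ω ^ 1 * Real.exp (t * ε ω) ∂μ) (𝓝[<] 0)
      (𝓝 (θ * α / β)) := by
    have hc : ContinuousAt (fun t => α * θ / ((β - t) * D t ^ 2)) 0 := by
      refine ContinuousAt.div (by fun_prop) (by fun_prop) ?_
      simp [hD_zero, hβ.ne']
    have h := hc.tendsto.mono_left (nhdsWithin_le_nhds (s := Set.Iio 0))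
    simp only [hD_zero, sub_zero, one_pow, mul_one, mul_comm α θ] at h
    refine h.congr' ?_
    filter_upwards [self_mem_nhdsWithin] with t ht
    rw [h_one t ht, mul_comm α θ]
  have hL2 : Tendsto (fun t => ∫ ω, ε ω ^ 2 * Real.exp (t * ε ω) ∂μ) (𝓝[<] 0)
      (𝓝 ((θ * α + 2 * θ ^ 2 * α ^ 2) / β ^ 2)) := by
    have hc : ContinuousAt
        (fun t => α * θ * (D t + 2 * (α * θ)) / ((β - t) ^ 2 * D t ^ 3)) 0 := by
      refine ContinuousAt.div (by fun_prop) (by fun_prop) ?_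
      simp [hD_zero, hβ.ne']
    have h := hc.tendsto.mono_left (nhdsWithin_le_nhds (s := Set.Iio 0))
    simp only [hD_zero, sub_zero, one_pow, mul_one] at h
    rw [show α * θ * (1 + 2 * (α * θ)) = θ * α + 2 * θ ^ 2 * α ^ 2 by ring] at h
    refine h.congr' ?_
    filter_upwards [self_mem_nhdsWithin] with t ht
    exact (h_two t ht).symm
  obtain ⟨hi1, he1⟩ :=
    integrable_pow_and_integral_eq_of_tendsto_exp_mul hεm hεnn 1 (hint 1) hL1
  obtain ⟨hi2, he2⟩ :=
    integrable_pow_and_integral_eq_of_tendsto_exp_mul hεm hεnn 2 (hint 2) hL2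
  simp only [pow_one] at hi1 he1
  exact ⟨hi1, hi2, he1, he2⟩
end

section
/- Let θ > 0, δ > 0 and γ > 0, and let ε be a nonnegative random variable with E[exp(-sε)] = 1/(1 + θγδ(√(1 + 2s/γ²) − 1)) for all s ≥ 0. Then ε has finite first and second moments given by E[ε] = θδ/γ and E[ε²] = 2θ²δ²/γ² + θδ/γ³. -/
open MeasureTheory

open Filter Topology in
/-- Fatou's lemma combined with dominated convergence: nonnegative functions that converge to `f`,
are bounded by a multiple of `f`, and have convergent integrals. -/
theorem integrable_and_integral_eq_of_tendsto_of_le_mul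
    {Ω : Type*} [MeasurableSpace Ω] {μ : Measure Ω} {F : ℕ → Ω → ℝ} {f : Ω → ℝ} {C L : ℝ}
    (hF : ∀ n, Integrable (F n) μ) (hf : AEStronglyMeasurable f μ)
    (h_nonneg : ∀ n, ∀ᵐ ω ∂μ, 0 ≤ F n ω) (h_le : ∀ n, ∀ᵐ ω ∂μ, F n ω ≤ C * f ω)
    (h_lim : ∀ᵐ ω ∂μ, Tendsto (fun n => F n ω) atTop (𝓝 (f ω)))
    (h_int : Tendsto (fun n => ∫ ω, F n ω ∂μ) atTop (𝓝 L)) :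
    Integrable f μ ∧ ∫ ω, f ω ∂μ = L := by
  have h_enorm : ∀ n, ∫⁻ ω, ‖F n ω‖ₑ ∂μ = ENNReal.ofReal (∫ ω, F n ω ∂μ) := fun n => by
    rw [ofReal_integral_eq_lintegral_ofReal (hF n) (h_nonneg n)]
    refine lintegral_congr_ae ?_
    filter_upwards [h_nonneg n] with ω hω
    exact Real.enorm_of_nonneg hω
  have hfi : Integrable f μ := by
    refine ⟨hf, ?_⟩
    calc ∫⁻ ω, ‖f ω‖ₑ ∂μ = ∫⁻ ω, liminf (fun n => ‖F n ω‖ₑ) atTop ∂μ := by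
          refine lintegral_congr_ae ?_
          filter_upwards [h_lim] with ω hω
          exact hω.enorm.liminf_eq.symm
      _ ≤ liminf (fun n => ∫⁻ ω, ‖F n ω‖ₑ ∂μ) atTop :=
          lintegral_liminf_le' fun n => (hF n).1.enorm
      _ = ENNReal.ofReal L := by
          simp_rw [h_enorm]
          exact ((ENNReal.continuous_ofReal.tendsto L).comp h_int).liminf_eq
      _ < ⊤ := ENNReal.ofReal_lt_top
  refine ⟨hfi, tendsto_nhds_unique ?_ h_int⟩
  refine tendsto_integral_of_dominated_convergence (fun ω => C * f ω) (fun n => (hF n).1)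
    (hfi.const_mul C) (fun n => ?_) h_lim
  filter_upwards [h_nonneg n, h_le n] with ω h0 h1
  rwa [Real.norm_of_nonneg h0]

open Filter Topology in
theorem tendsto_one_sub_exp_neg_mul_div (x : ℝ) :
    Tendsto (fun s : ℝ => (1 - Real.exp (-s * x)) / s) (𝓝[≠] 0) (𝓝 x) := by
  have h : HasDerivAt (fun s : ℝ => 1 - Real.exp (-s * x)) x 0 := by
    have := (((hasDerivAt_id (0 : ℝ)).neg.mul_const x).exp).const_sub 1
    simpa using this
  have := h.tendsto_slope_zero
  simpa [div_eq_inv_mul] using this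

open Filter Topology in
theorem tendsto_exp_neg_mul_sub_one_add_div_sq (x : ℝ) :
    Tendsto (fun s : ℝ => 2 * (Real.exp (-s * x) - 1 + s * x) / s ^ 2) (𝓝[≠] 0) (𝓝 (x ^ 2)) := by
  have h0 : Tendsto (fun s : ℝ => -s * x) (𝓝[≠] 0) (𝓝 0) := by
    have : Continuous fun s : ℝ => -s * x := by fun_prop
    exact (this.tendsto' 0 0 (by simp)).mono_left nhdsWithin_le_nhds
  have h1 := (Real.exp_sub_sum_range_succ_isLittleO_pow 2).comp_tendsto h0
  have h2 : ((fun s : ℝ => s ^ 2) ∘ fun s => -s * x) =O[𝓝[≠] 0] fun s : ℝ => s ^ 2 := by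
    refine Asymptotics.IsBigO.of_bound (x ^ 2) (Eventually.of_forall fun s => le_of_eq ?_)
    simp [mul_pow, mul_comm]
  have h3 := ((h1.trans_isBigO h2).tendsto_div_nhds_zero.const_mul 2).add_const (x ^ 2)
  simp only [mul_zero, zero_add] at h3
  refine h3.congr' ?_
  filter_upwards [self_mem_nhdsWithin] with s hs
  have hs : s ≠ 0 := hs
  simp only [Function.comp, Finset.sum_range_succ, Finset.sum_range_zero, Nat.factorial]
  push_cast
  field_simp
  ring

theorem Real.exp_neg_sub_one_add_le_sq {y : ℝ} (hy : 0 ≤ y) : Real.exp (-y) - 1 + y ≤ y ^ 2 := by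
  rcases le_total y 1 with h | h
  · have := Real.abs_exp_sub_one_sub_id_le (x := -y) (by rwa [abs_neg, abs_of_nonneg hy])
    have := (le_abs_self _).trans this
    linarith [neg_sq y]
  · have : Real.exp (-y) ≤ 1 := Real.exp_le_one_iff.2 (by linarith)
    nlinarith

open Filter Topology in
/-- First and second moments of the geometric inverse Gaussian innovation distribution. -/
theorem geometric_inverse_gaussian_moments
    {Ω : Type*} [MeasurableSpace Ω] (μ : Measure Ω) [IsProbabilityMeasure μ]
    (ε : Ω → ℝ) (hεm : Measurable ε) (hεnn : ∀ᵐ ω ∂μ, 0 ≤ ε ω)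
    (θ δ γ : ℝ) (hθ : 0 < θ) (hδ : 0 < δ) (hγ : 0 < γ)
    (hLap : ∀ s ≥ 0, ∫ ω, Real.exp (-s * ε ω) ∂μ
      = 1 / (1 + θ * γ * δ * (Real.sqrt (1 + 2 * s / γ ^ 2) - 1))) :
    Integrable ε μ ∧ Integrable (fun ω => ε ω ^ 2) μ ∧
    ∫ ω, ε ω ∂μ = θ * δ / γ ∧
    ∫ ω, ε ω ^ 2 ∂μ = 2 * θ ^ 2 * δ ^ 2 / γ ^ 2 + θ * δ / γ ^ 3 := by
  have hexp : ∀ s : ℝ, 0 ≤ s → Integrable (fun ω => Real.exp (-s * ε ω)) μ := fun s hs => by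
    refine Integrable.of_bound (by fun_prop) 1 ?_
    filter_upwards [hεnn] with ω hω
    rw [Real.norm_of_nonneg (Real.exp_pos _).le]
    exact Real.exp_le_one_iff.2 (by nlinarith)
  -- Substituting `s = γ² (u + u² / 2)` makes the Laplace transform rational in `u`.
  let u : ℕ → ℝ := fun n => 1 / ((n : ℝ) + 1)
  let s : ℕ → ℝ := fun n => γ ^ 2 * (u n + u n ^ 2 / 2)
  have hu : ∀ n, 0 < u n := fun n => Nat.one_div_pos_of_nat
  have hs : ∀ n, 0 < s n := fun n => by have := hu n; positivity
  have hu0 : Tendsto u atTop (𝓝 0) := tendsto_one_div_add_atTop_nhds_zero_nat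
  have hs0 : Tendsto s atTop (𝓝[≠] 0) := by
    refine tendsto_nhdsWithin_iff.2 ⟨?_, Eventually.of_forall fun n => (hs n).ne'⟩
    have : Continuous fun v : ℝ => γ ^ 2 * (v + v ^ 2 / 2) := by fun_prop
    exact (this.tendsto' 0 0 (by simp)).comp hu0
  have hφ : ∀ n, ∫ ω, Real.exp (-s n * ε ω) ∂μ = 1 / (1 + θ * γ * δ * u n) := fun n => by
    rw [hLap _ (hs n).le]
    have h : 1 + 2 * s n / γ ^ 2 = (1 + u n) ^ 2 := by
      simp only [s]; field_simp; ring
    rw [h, Real.sqrt_sq (by linarith [hu n]), add_sub_cancel_left]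
  obtain ⟨hi, hm⟩ : Integrable ε μ ∧ ∫ ω, ε ω ∂μ = θ * δ / γ := by
    refine integrable_and_integral_eq_of_tendsto_of_le_mul (C := 1)
      (F := fun n ω => (1 - Real.exp (-s n * ε ω)) / s n)
      (fun n => ((integrable_const 1).sub (hexp _ (hs n).le)).div_const _)
      hεm.aestronglyMeasurable (fun n => ?_) (fun n => ?_)
      (Eventually.of_forall fun ω => (tendsto_one_sub_exp_neg_mul_div (ε ω)).comp hs0) ?_
    · filter_upwards [hεnn] with ω hω
      have : Real.exp (-s n * ε ω) ≤ 1 := Real.exp_le_one_iff.2 (by nlinarith [hs n])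
      exact div_nonneg (by linarith) (hs n).le
    · refine Eventually.of_forall fun ω => ?_
      rw [div_le_iff₀ (hs n)]
      linarith [Real.add_one_le_exp (-s n * ε ω)]
    · have hc : ContinuousAt
          (fun v : ℝ => θ * γ * δ / ((1 + θ * γ * δ * v) * γ ^ 2 * (1 + v / 2))) 0 :=
        ContinuousAt.div (by fun_prop) (by fun_prop) (by simp [hγ.ne'])
      have hl := hc.tendsto.comp hu0
      have he : θ * γ * δ / ((1 + θ * γ * δ * 0) * γ ^ 2 * (1 + 0 / 2)) = θ * δ / γ := by
        field_simp; simp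
      rw [he] at hl
      refine hl.congr fun n => ?_
      rw [integral_div, integral_sub (integrable_const 1) (hexp _ (hs n).le), hφ]
      have := hu n
      have h1 : 1 + θ * γ * δ * u n ≠ 0 := by positivity
      simp only [s, Function.comp, integral_const, probReal_univ, smul_eq_mul]
      field_simp
      ring
  obtain ⟨hi2, hm2⟩ : Integrable (fun ω => ε ω ^ 2) μ ∧
      ∫ ω, ε ω ^ 2 ∂μ = 2 * θ ^ 2 * δ ^ 2 / γ ^ 2 + θ * δ / γ ^ 3 := by
    have hi' : ∀ n, Integrable (fun ω => Real.exp (-s n * ε ω) - 1) μ :=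
      fun n => (hexp _ (hs n).le).sub (integrable_const 1)
    refine integrable_and_integral_eq_of_tendsto_of_le_mul (C := 2)
      (F := fun n ω => 2 * (Real.exp (-s n * ε ω) - 1 + s n * ε ω) / s n ^ 2)
      (fun n => (((hi' n).add (hi.const_mul _)).const_mul 2).div_const _)
      (hεm.pow_const 2).aestronglyMeasurable (fun n => ?_) (fun n => ?_)
      (Eventually.of_forall fun ω => (tendsto_exp_neg_mul_sub_one_add_div_sq (ε ω)).comp hs0) ?_
    · refine Eventually.of_forall fun ω => ?_
      have := Real.add_one_le_exp (-s n * ε ω)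
      exact div_nonneg (by linarith) (sq_nonneg _)
    · filter_upwards [hεnn] with ω hω
      have := Real.exp_neg_sub_one_add_le_sq (mul_nonneg (hs n).le hω)
      rw [← neg_mul] at this
      rw [div_le_iff₀ (pow_pos (hs n) 2)]
      linarith [mul_pow (s n) (ε ω) 2]
    · have hc : ContinuousAt
          (fun v : ℝ => θ * γ * δ * (1 + 2 * (θ * γ * δ) + θ * γ * δ * v) /
            ((1 + θ * γ * δ * v) * γ ^ 4 * (1 + v / 2) ^ 2)) 0 :=
        ContinuousAt.div (by fun_prop) (by fun_prop) (by simp [hγ.ne'])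
      have hl := hc.tendsto.comp hu0
      have he : θ * γ * δ * (1 + 2 * (θ * γ * δ) + θ * γ * δ * 0) /
            ((1 + θ * γ * δ * 0) * γ ^ 4 * (1 + 0 / 2) ^ 2) =
          2 * θ ^ 2 * δ ^ 2 / γ ^ 2 + θ * δ / γ ^ 3 := by
        simp only [mul_zero, add_zero, zero_div, one_pow, one_mul, mul_one]
        field_simp
        ring
      rw [he] at hl
      refine hl.congr fun n => ?_
      rw [integral_div, integral_const_mul, integral_add (hi' n) (hi.const_mul _),
        integral_sub (hexp _ (hs n).le) (integrable_const 1), hφ, integral_const_mul, hm]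
      have := hu n
      have h1 : 1 + θ * γ * δ * u n ≠ 0 := by positivity
      simp only [s, Function.comp, integral_const, probReal_univ, smul_eq_mul]
      field_simp
      ring
  exact ⟨hi, hi2, hm, hm2⟩
end

section
/- Let k ∈ ℕ, k ≥ 1, let 0 < θ < 1 and θ₁, ..., θ_k ≥ 0 with Σ_{i=1}^k θ_i = 1 − θ. Let Y₁, ..., Y_k, ε be nonnegative random variables and J a random variable with values in {0, 1, ..., k} with P(J = 0) = θ and P(J = i) = θ_i for i = 1, ..., k, such that ε is independent of (Y₁, ..., Y_k) and J is independent of (Y₁, ..., Y_k, ε). Suppose each Y_i has the same Laplace transform φ_Y(s) = E[exp(-s Y_i)] for s > 0, and that the random variable Z = ε + Σ_{i=1}^k 1_{{J = i}} Y_i also has Laplace transform φ_Y. Then E[exp(-sε)] = φ_Y(s) / (θ + (1 − θ) φ_Y(s)) for all s > 0; in particular, if φ_Y(s) = 1/(1 + g(s)) then E[exp(-sε)] = 1/(1 + θ g(s)). -/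
open MeasureTheory ProbabilityTheory

theorem ProbabilityTheory.IndepFun.integral_ite_eq_mul {Ω α β : Type*} [MeasurableSpace Ω]
    {μ : Measure Ω} [MeasurableSpace α] [MeasurableSingletonClass α] [DecidableEq α]
    [MeasurableSpace β] {J : Ω → α} {X : Ω → β} {f : β → ℝ} (h : IndepFun J X μ)
    (hJ : Measurable J) (hX : Measurable X) (hf : Measurable f) (a : α) :
    ∫ ω, (if J ω = a then f (X ω) else 0) ∂μ = μ.real {ω | J ω = a} * ∫ ω, f (X ω) ∂μ := by
  have hg : Measurable (fun j : α => if j = a then (1 : ℝ) else 0) :=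
    Measurable.ite (measurableSet_singleton a) measurable_const measurable_const
  have hind : ∫ ω, (if J ω = a then (1 : ℝ) else 0) ∂μ = μ.real {ω | J ω = a} := by
    rw [← integral_indicator_one (s := {ω | J ω = a}) (hJ (measurableSet_singleton a))]
    simp [Set.indicator_apply]
  have hmul := (h.comp hg hf).integral_fun_mul_eq_mul_integral
    (hg.comp hJ).aestronglyMeasurable (hf.comp hX).aestronglyMeasurable
  simpa [Function.comp_def, hind] using hmul

theorem MeasureTheory.integrable_exp_neg_mul_of_nonneg {Ω : Type*} [MeasurableSpace Ω]
    {μ : Measure Ω} [IsFiniteMeasure μ] {X : Ω → ℝ} (hX : Measurable X)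
    (hX0 : ∀ᵐ ω ∂μ, 0 ≤ X ω) {s : ℝ} (hs : 0 ≤ s) :
    Integrable (fun ω => Real.exp (-s * X ω)) μ := by
  refine Integrable.of_bound (by fun_prop) 1 ?_
  filter_upwards [hX0] with ω hω
  rw [Real.norm_eq_abs, Real.abs_exp, Real.exp_le_one_iff]
  nlinarith [mul_nonneg hs hω]

/-- On `{j ≤ k}`, the exponential of the random selection splits along the value of `j`. -/
theorem Real.exp_neg_mul_add_sum_ite {k j : ℕ} (hj : j ≤ k) (s e : ℝ) (y : Fin k → ℝ) :
    Real.exp (-s * (e + ∑ i : Fin k, if j = (i : ℕ) + 1 then y i else 0)) =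
      (if j = 0 then Real.exp (-s * e) else 0) +
        ∑ i : Fin k, if j = (i : ℕ) + 1 then Real.exp (-s * e) * Real.exp (-s * y i) else 0 := by
  rcases j with _ | j
  · simp
  · have hiff : ∀ i : Fin k, j + 1 = (i : ℕ) + 1 ↔ (⟨j, hj⟩ : Fin k) = i := by
      intro i
      simp [Fin.ext_iff]
    simp only [hiff, Finset.sum_ite_eq, Finset.mem_univ, if_true, Nat.add_eq_zero_iff, one_ne_zero,
      and_false, if_false, zero_add]
    rw [← Real.exp_add, mul_add]

/-- Stationarity equation of the k-th order gid autoregressive model: if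
`Z = ε + Σ_i 1_{J=i} Y_i` has the same Laplace transform `φ` as each `Y_i`, then the
innovation Laplace transform is `φ(s)/(θ + (1-θ)φ(s))`; in particular, if
`φ(s) = 1/(1+g(s))` then `E[exp(-sε)] = 1/(1+θ g(s))`. -/
theorem gid_ARk_innovation_laplace
    {Ω : Type*} [MeasurableSpace Ω] (μ : Measure Ω) [IsProbabilityMeasure μ]
    (k : ℕ) (hk : 1 ≤ k) (θ : ℝ) (θ' : Fin k → ℝ) (hθ0 : 0 < θ) (hθ1 : θ < 1)
    (hθ'nn : ∀ i, 0 ≤ θ' i) (hsum : ∑ i, θ' i = 1 - θ)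
    (Y : Fin k → Ω → ℝ) (ε : Ω → ℝ) (J : Ω → ℕ)
    (hYm : ∀ i, Measurable (Y i)) (hεm : Measurable ε) (hJm : Measurable J)
    (hYnn : ∀ i, ∀ᵐ ω ∂μ, 0 ≤ Y i ω) (hεnn : ∀ᵐ ω ∂μ, 0 ≤ ε ω)
    (hJrange : ∀ᵐ ω ∂μ, J ω ≤ k)
    (hJ0 : μ {ω | J ω = 0} = ENNReal.ofReal θ)
    (hJi : ∀ i : Fin k, μ {ω | J ω = (i : ℕ) + 1} = ENNReal.ofReal (θ' i))
    (hindepε : IndepFun ε (fun ω i => Y i ω) μ)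
    (hindepJ : IndepFun J (fun ω => ((fun i => Y i ω), ε ω)) μ)
    (φ : ℝ → ℝ)
    (hLapY : ∀ i, ∀ s > 0, ∫ ω, Real.exp (-s * Y i ω) ∂μ = φ s)
    (hLapZ : ∀ s > 0,
      ∫ ω, Real.exp (-s * (ε ω + ∑ i : Fin k, if J ω = (i : ℕ) + 1 then Y i ω else 0)) ∂μ = φ s) :
    (∀ s > 0, ∫ ω, Real.exp (-s * ε ω) ∂μ = φ s / (θ + (1 - θ) * φ s)) ∧
    ∀ g : ℝ → ℝ, (∀ s > 0, φ s = 1 / (1 + g s)) →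
      ∀ s > 0, ∫ ω, Real.exp (-s * ε ω) ∂μ = 1 / (1 + θ * g s) := by
  have hYεm : Measurable (fun ω => ((fun i => Y i ω), ε ω)) :=
    (measurable_pi_lambda _ hYm).prodMk hεm
  have hYint : ∀ i, ∀ s > 0, Integrable (fun ω => Real.exp (-s * Y i ω)) μ := fun i s hs =>
    integrable_exp_neg_mul_of_nonneg (hYm i) (hYnn i) (le_of_lt hs)
  have hεint : ∀ s > 0, Integrable (fun ω => Real.exp (-s * ε ω)) μ := fun s hs =>
    integrable_exp_neg_mul_of_nonneg hεm hεnn (le_of_lt hs)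
  have hφpos : ∀ s > 0, 0 < φ s := fun s hs => by
    rw [← hLapY ⟨0, hk⟩ s hs]
    exact integral_exp_pos (hYint _ s hs)
  have hindep : ∀ (i : Fin k) (s : ℝ),
      IndepFun (fun ω => Real.exp (-s * ε ω)) (fun ω => Real.exp (-s * Y i ω)) μ := fun i s =>
    hindepε.comp (φ := fun x => Real.exp (-s * x)) (ψ := fun y : Fin k → ℝ => Real.exp (-s * y i))
      (by fun_prop) (by fun_prop)
  have hstat : ∀ s > 0, φ s = (∫ ω, Real.exp (-s * ε ω) ∂μ) * (θ + (1 - θ) * φ s) := by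
    intro s hs
    have hmeas : ∀ j : ℕ, MeasurableSet {ω | J ω = j} := fun j => hJm (measurableSet_singleton j)
    have hprod : ∀ i, Integrable (fun ω => Real.exp (-s * ε ω) * Real.exp (-s * Y i ω)) μ :=
      fun i => (hindep i s).integrable_mul (hεint s hs) (hYint i s hs)
    have hint0 : Integrable (fun ω => if J ω = 0 then Real.exp (-s * ε ω) else 0) μ :=
      ((hεint s hs).indicator (hmeas 0)).congr
        (.of_forall fun ω => by simp [Set.indicator_apply])
    have hint : ∀ i : Fin k, Integrable (fun ω => if J ω = (i : ℕ) + 1 then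
        Real.exp (-s * ε ω) * Real.exp (-s * Y i ω) else 0) μ :=
      fun i => ((hprod i).indicator (hmeas (i + 1))).congr
        (.of_forall fun ω => by simp [Set.indicator_apply])
    have h0 : ∫ ω, (if J ω = 0 then Real.exp (-s * ε ω) else 0) ∂μ =
        θ * ∫ ω, Real.exp (-s * ε ω) ∂μ := by
      rw [hindepJ.integral_ite_eq_mul (f := fun p => Real.exp (-s * p.2)) hJm hYεm
        (by fun_prop) 0, measureReal_def, hJ0, ENNReal.toReal_ofReal hθ0.le]
    have hi : ∀ i : Fin k, ∫ ω, (if J ω = (i : ℕ) + 1 then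
        Real.exp (-s * ε ω) * Real.exp (-s * Y i ω) else 0) ∂μ =
        θ' i * ((∫ ω, Real.exp (-s * ε ω) ∂μ) * φ s) := by
      intro i
      rw [hindepJ.integral_ite_eq_mul
        (f := fun p => Real.exp (-s * p.2) * Real.exp (-s * p.1 i)) hJm hYεm
        (by fun_prop) (i + 1), measureReal_def, hJi, ENNReal.toReal_ofReal (hθ'nn i),
        (hindep i s).integral_fun_mul_eq_mul_integral (hεint s hs).aestronglyMeasurable
          (hYint i s hs).aestronglyMeasurable, hLapY i s hs]
    have hsplit := integral_congr_ae (μ := μ) (hJrange.mono fun ω hω =>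
      Real.exp_neg_mul_add_sum_ite hω s (ε ω) (fun i => Y i ω))
    rw [hLapZ s hs, integral_add hint0 (integrable_finsetSum _ fun i _ => hint i),
      integral_finsetSum _ fun i _ => hint i, h0, Finset.sum_congr rfl fun i _ => hi i,
      ← Finset.sum_mul, hsum] at hsplit
    linarith
  have hmain : ∀ s > 0, ∫ ω, Real.exp (-s * ε ω) ∂μ = φ s / (θ + (1 - θ) * φ s) := by
    intro s hs
    have hden : 0 < θ + (1 - θ) * φ s :=
      add_pos hθ0 (mul_pos (sub_pos.mpr hθ1) (hφpos s hs))
    rw [eq_div_iff hden.ne']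
    exact (hstat s hs).symm
  refine ⟨hmain, fun g hg s hs => ?_⟩
  have hg0 : 0 < 1 + g s := one_div_pos.mp (hg s hs ▸ hφpos s hs)
  have hden : θ * (1 + g s) + (1 - θ) = 1 + θ * g s := by ring
  rw [hmain s hs, hg s hs, ← hden]
  field_simp
end
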